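/- Covering of closed edges on a geodesic: let γ be a geodesic of T(0*, (n·e1)*) and suppose that { 0*, (n·e1)* } is not contained in Λ_{3R_e}(e) for every closed edge e of γ. Then: (i) every closed edge e of γ satisfies R_e ≥ log² n / (2 C_*); (ii) there exists a subset Γ of the closed edges of γ such that (iia) for all distinct e, e' ∈ Γ, ‖e − e'‖∞ ≥ max{ R_e, R_{e'} }, and (iib) |D*_n − T(0*, (n·e1)*)| ≤ 2 C_* Σ_{e∈Γ} R_e. -/

import Mathlib

open MeasureTheory
open scoped ENNReal NNReal

attribute [local instance] Classical.propDecidable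

noncomputable section

namespace Perco

/-- Vertices of the lattice `ℤ^d`. -/
abbrev ZVec (d : ℕ) := Fin d → ℤ

/-- The `ℓ¹` norm of a lattice point (as a natural number). -/
def norm1 (d : ℕ) (x : ZVec d) : ℕ := ∑ i, (x i).natAbs

/-- The `ℓ∞` norm of a lattice point (as a natural number). -/
def normInf (d : ℕ) (x : ZVec d) : ℕ := Finset.univ.sup fun i => (x i).natAbs

/-- Nearest-neighbour edges of `ℤ^d`, each written `(x_e, y_e)` with `‖x_e‖₁ < ‖y_e‖₁`. -/
def EdgeD (d : ℕ) := {e : ZVec d × ZVec d // norm1 d (e.1 - e.2) = 1 ∧ norm1 d e.1 < norm1 d e.2}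

/-- A percolation configuration: each edge is open (`true`) or closed (`false`). -/
abbrev Config (d : ℕ) := EdgeD d → Bool

/-- Adjacency in `ℤ^d`. -/
def Adj (d : ℕ) (x y : ZVec d) : Prop := norm1 d (x - y) = 1

/-- A (self-avoiding, nearest-neighbour) path, recorded as its list of vertices. -/
def IsPath (d : ℕ) (γ : List (ZVec d)) : Prop :=
  γ ≠ [] ∧ γ.Nodup ∧ γ.Chain' (Adj d)

/-- The (unordered) edge `{x,y}` is open in the configuration `ω`. -/
def EdgeOpen (d : ℕ) (ω : Config d) (x y : ZVec d) : Prop :=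
  ∃ e : EdgeD d, (e.val = (x, y) ∨ e.val = (y, x)) ∧ ω e = true

/-- All edges of the path are open. -/
def IsOpenPath (d : ℕ) (ω : Config d) (γ : List (ZVec d)) : Prop :=
  γ.Chain' (EdgeOpen d ω)

/-- The (unordered) edge `{x,y}` is an edge of the path `γ`. -/
def edgeMemPath (d : ℕ) (x y : ZVec d) (γ : List (ZVec d)) : Prop :=
  (x, y) ∈ γ.zip γ.tail ∨ (y, x) ∈ γ.zip γ.tail

/-- Truncated FPP weight of the edge `{x,y}`: `1` if open, `log² n` if closed. -/
def pairWeight (d n : ℕ) (ω : Config d) (x y : ZVec d) : ℝ :=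
  if EdgeOpen d ω x y then 1 else (Real.log n) ^ 2

/-- Total truncated weight of a path. -/
def pathCost (d n : ℕ) (ω : Config d) : List (ZVec d) → ℝ
  | [] => 0
  | [_] => 0
  | x :: y :: rest => pairWeight d n ω x y + pathCost d n ω (y :: rest)

/-- Truncated first-passage time between `x` and `y`. -/
def passageTime (d n : ℕ) (ω : Config d) (x y : ZVec d) : ℝ :=
  sInf {c : ℝ | ∃ γ : List (ZVec d), IsPath d γ ∧ γ.head? = some x ∧
    γ.getLast? = some y ∧ pathCost d n ω γ = c}

/-- Chemical distance between `x` and `y` using only open paths inside `U`. -/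
def chemDistIn (d : ℕ) (ω : Config d) (U : Set (ZVec d)) (x y : ZVec d) : ℕ∞ :=
  sInf {k : ℕ∞ | ∃ γ : List (ZVec d), IsPath d γ ∧ IsOpenPath d ω γ ∧ (∀ v ∈ γ, v ∈ U) ∧
    γ.head? = some x ∧ γ.getLast? = some y ∧ ((γ.length - 1 : ℕ) : ℕ∞) = k}

/-- Chemical distance in the whole lattice. -/
def chemDist (d : ℕ) (ω : Config d) (x y : ZVec d) : ℕ∞ := chemDistIn d ω Set.univ x y

/-- `x` belongs to an infinite open cluster. -/
def InInfCluster (d : ℕ) (ω : Config d) (x : ZVec d) : Prop :=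
  {y | chemDist d ω x y ≠ ⊤}.Infinite

/-- `x*`: a point of the infinite cluster at minimal `ℓ∞`-distance from `x`
(deterministic tie-breaking via choice); `x` itself if there is no infinite cluster. -/
def starPt (d : ℕ) (ω : Config d) (x : ZVec d) : ZVec d :=
  if h : ∃ y, InInfCluster d ω y ∧ ∀ z, InInfCluster d ω z →
      normInf d (y - x) ≤ normInf d (z - x)
  then h.choose else x

/-- `μ` is the Bernoulli(p) bond-percolation product measure on configurations. -/
def IsBernoulli (d : ℕ) (p : ℝ) (μ : Measure (Config d)) : Prop :=
  IsProbabilityMeasure μ ∧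
  ∀ (s : Finset (EdgeD d)) (f : EdgeD d → Bool),
    μ {ω | ∀ e ∈ s, ω e = f e} = ∏ e ∈ s, ENNReal.ofReal (if f e then p else 1 - p)

/-- The critical parameter of Bernoulli bond percolation on `ℤ^d`. -/
def pc (d : ℕ) : ℝ :=
  sSup {p : ℝ | 0 ≤ p ∧ p ≤ 1 ∧ ∀ μ : Measure (Config d), IsBernoulli d p μ →
    μ {ω | ∃ x, InInfCluster d ω x} = 0}

/-- The point `n·e₁`. -/
def ptE1 (d n : ℕ) : ZVec d := fun i => if (i : ℕ) = 0 then (n : ℤ) else 0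

/-- `D*_n = D(0*, (n e₁)*)`, as a real number. -/
def DstarR (d n : ℕ) (ω : Config d) : ℝ :=
  ((chemDist d ω (starPt d ω 0) (starPt d ω (ptE1 d n))).toNat : ℝ)

/-- `T_n = T(0, n e₁)`, the truncated passage time. -/
def TnR (d n : ℕ) (ω : Config d) : ℝ := passageTime d n ω 0 (ptE1 d n)

/-- The box `Λ_t(z)` with integer radius. -/
def boxZ (d : ℕ) (t : ℕ) (z : ZVec d) : Set (ZVec d) := {y | normInf d (y - z) ≤ t}

/-- The box `Λ_t(z)` with real radius. -/
def boxR (d : ℕ) (t : ℝ) (z : ZVec d) : Set (ZVec d) := {y | (normInf d (y - z) : ℝ) ≤ t}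

/-- The annulus `A_N(e) = Λ_{3N}(e) \ Λ_N(e)`. -/
def annulus (d : ℕ) (N : ℕ) (e : EdgeD d) : Set (ZVec d) :=
  {y | normInf d (y - e.val.1) ≤ 3 * N ∧ N < normInf d (y - e.val.1)}

/-- `π` is a geodesic of the truncated passage time between its endpoints, inside `A`. -/
def IsGeodesicIn (d n : ℕ) (ω : Config d) (A : Set (ZVec d)) (π : List (ZVec d)) : Prop :=
  IsPath d π ∧ (∀ v ∈ π, v ∈ A) ∧
  ∀ π' : List (ZVec d), IsPath d π' → (∀ v ∈ π', v ∈ A) →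
    π'.head? = π.head? → π'.getLast? = π.getLast? →
    pathCost d n ω π ≤ pathCost d n ω π'

/-- `γ ∈ 𝔾_*(A)`: a path in `A` obtained from some geodesic in `A` by replacing
segments by open paths (all edges of `γ` not on the geodesic are open). -/
def GstarIn (d n : ℕ) (ω : Config d) (A : Set (ZVec d)) (γ : List (ZVec d)) : Prop :=
  IsPath d γ ∧ (∀ v ∈ γ, v ∈ A) ∧
  ∃ π : List (ZVec d), IsGeodesicIn d n ω A π ∧
    ∀ x y, edgeMemPath d x y γ → ¬ edgeMemPath d x y π → EdgeOpen d ω x y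

/-- `γ` is a crossing path of the annulus `A_N(e)`. -/
def IsCrossing (d : ℕ) (N : ℕ) (e : EdgeD d) (γ : List (ZVec d)) : Prop :=
  IsPath d γ ∧ (∀ v ∈ γ, v ∈ annulus d N e) ∧
  (∃ v ∈ γ, normInf d (v - e.val.1) = N + 1) ∧ (∃ v ∈ γ, normInf d (v - e.val.1) = 3 * N)

/-- The event `𝒱¹_N(e)`: any two modified geodesics crossing `A_N(e)` are linked by an
open path inside `A_N(e)` of length at most `C_* N`. -/
def V1 (d : ℕ) (Cstar : ℝ) (n : ℕ) (e : EdgeD d) (N : ℕ) (ω : Config d) : Prop :=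
  ∀ γ1 γ2 : List (ZVec d),
    GstarIn d n ω (boxR d (Cstar * N) e.val.1) γ1 → IsCrossing d N e γ1 →
    GstarIn d n ω (boxR d (Cstar * N) e.val.1) γ2 → IsCrossing d N e γ2 →
    ∃ π : List (ZVec d), IsPath d π ∧ IsOpenPath d ω π ∧ (∀ v ∈ π, v ∈ annulus d N e) ∧
      (∃ u, π.head? = some u ∧ u ∈ γ1) ∧ (∃ v, π.getLast? = some v ∧ v ∈ γ2) ∧
      ((π.length : ℝ) - 1 ≤ Cstar * N)

/-- The event `𝒱²_N(e)`: points of `Λ_{3N}(e)` openly connected inside `Λ_{3N}(e)` are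
connected inside `Λ_{4N}(e)` by an open path of length at most `C_* N`. -/
def V2 (d : ℕ) (Cstar : ℝ) (e : EdgeD d) (N : ℕ) (ω : Config d) : Prop :=
  ∀ x y : ZVec d, x ∈ boxZ d (3 * N) e.val.1 → y ∈ boxZ d (3 * N) e.val.1 →
    (∃ γ, IsPath d γ ∧ IsOpenPath d ω γ ∧ (∀ v ∈ γ, v ∈ boxZ d (3 * N) e.val.1) ∧
      γ.head? = some x ∧ γ.getLast? = some y) →
    ∃ γ, IsPath d γ ∧ IsOpenPath d ω γ ∧ (∀ v ∈ γ, v ∈ boxZ d (4 * N) e.val.1) ∧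
      γ.head? = some x ∧ γ.getLast? = some y ∧ ((γ.length : ℝ) - 1 ≤ Cstar * N)

/-- The effective radius `R_e` as a natural number (`0` when undefined). -/
def ReffN (d : ℕ) (Cstar : ℝ) (n : ℕ) (e : EdgeD d) (ω : Config d) : ℕ :=
  sInf {N : ℕ | 1 ≤ N ∧ V1 d Cstar n e N ω ∧ V2 d Cstar e N ω}

/-- The effective radius `R_e`, valued in `ℝ≥0∞` (`∞` when undefined). -/
def ReffENN (d : ℕ) (Cstar : ℝ) (n : ℕ) (e : EdgeD d) (ω : Config d) : ℝ≥0∞ :=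
  sInf {r : ℝ≥0∞ | ∃ N : ℕ, r = N ∧ 1 ≤ N ∧ V1 d Cstar n e N ω ∧ V2 d Cstar e N ω}

/-- The truncated effective radius `R̂_e = min (C_* R_e) (log² n)`. -/
def RhatR (d : ℕ) (Cstar : ℝ) (n : ℕ) (e : EdgeD d) (ω : Config d) : ℝ :=
  (min (ENNReal.ofReal Cstar * ReffENN d Cstar n e ω)
    (ENNReal.ofReal ((Real.log n) ^ 2))).toReal

/-- `diam(γ) ≥ r`. -/
def DiamGE (d : ℕ) (γ : List (ZVec d)) (r : ℝ) : Prop :=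
  ∃ i : Fin d, ∃ x ∈ γ, ∃ y ∈ γ, r ≤ |((x i : ℤ) : ℝ) - ((y i : ℤ) : ℝ)|

/-- The boundary `∂Λ_t` (real radius `t`). -/
def bdryR (d : ℕ) (t : ℝ) : Set (ZVec d) :=
  {x | (normInf d x : ℝ) ≤ t ∧ t - 1 < (normInf d x : ℝ)}

/-- The slab `S(ℓ,t) = {x ∈ Λ_t : 0 ≤ x₁ ≤ ℓ}`. -/
def slab (d : ℕ) (l t : ℝ) : Set (ZVec d) :=
  {x | (normInf d x : ℝ) ≤ t ∧ ∀ i : Fin d, (i : ℕ) = 0 → 0 ≤ x i ∧ ((x i : ℤ) : ℝ) ≤ l}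

/-- The open cluster of the vertex `v`. -/
def openClusterOf (d : ℕ) (ω : Config d) (v : ZVec d) : Set (ZVec d) :=
  {y | chemDist d ω v y ≠ ⊤}

/-- The set `C` crosses the box `Λ_t(z)`: in each direction an open path of `C ∩ Λ_t(z)`
connects the two opposite faces. -/
def CrossesBox (d : ℕ) (ω : Config d) (C : Set (ZVec d)) (t : ℕ) (z : ZVec d) : Prop :=
  ∀ i : Fin d, ∃ γ, IsPath d γ ∧ IsOpenPath d ω γ ∧ (∀ u ∈ γ, u ∈ C ∧ u ∈ boxZ d t z) ∧
    (∃ u ∈ γ, u i = z i - t) ∧ (∃ u ∈ γ, u i = z i + t)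

/-- The event `𝓔_N`: some crossing open cluster of `Λ_{2N}` is avoided by a modified
geodesic `π ⊆ Λ_N` of diameter at least `N/2` belonging to `𝔾_*(Λ_{tN})`. -/
def ENevent (d n : ℕ) (t : ℝ) (N : ℕ) : Set (Config d) :=
  {ω | ∃ v0 : ZVec d, CrossesBox d ω (openClusterOf d ω v0) (2 * N) 0 ∧
    ∃ π : List (ZVec d), IsPath d π ∧ (∀ u ∈ π, u ∈ boxZ d N 0) ∧
      GstarIn d n ω (boxR d (t * N) 0) π ∧ DiamGE d π ((N : ℝ) / 2) ∧
      ∀ u ∈ π, u ∉ openClusterOf d ω v0}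

/-- `ρ` is a Garet–Marchand moderate-deviation constant for the chemical distance. -/
def GMprop (d : ℕ) (μ : Measure (Config d)) (ρ : ℝ) : Prop :=
  1 ≤ ρ ∧ ∃ c : ℝ, 0 < c ∧ ∀ x : ZVec d, ∀ t : ℝ, ρ * (normInf d x : ℝ) ≤ t →
    μ {ω | chemDist d ω 0 x ≠ ⊤ ∧ t ≤ ((chemDist d ω 0 x).toNat : ℝ)}
      ≤ ENNReal.ofReal (c⁻¹ * Real.exp (-c * t)) ∧
    μ {ω | t ≤ ((chemDist d ω (starPt d ω 0) (starPt d ω x)).toNat : ℝ) ∨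
        chemDist d ω (starPt d ω 0) (starPt d ω x) = ⊤}
      ≤ ENNReal.ofReal (c⁻¹ * Real.exp (-c * t))

/-- `cs` is a constant for which the crossing-cluster avoidance lemma holds. -/
def CrossProp (d : ℕ) (μ : Measure (Config d)) (cs : ℝ) : Prop :=
  0 < cs ∧ cs < 1 ∧ ∀ n : ℕ, 2 ≤ n → ∀ t : ℝ, 1 / cs ≤ t → ∀ N : ℕ, 1 ≤ N →
    (N : ℝ) ≤ Real.exp (cs * (Real.log n) ^ 2) →
    μ (ENevent d n t N) ≤ ENNReal.ofReal (cs⁻¹ * Real.exp (-cs * N))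

/-- `N_ρ = ⌊N / (16 ρ²)⌋`. -/
def Nrho (ρ : ℝ) (N : ℕ) : ℕ := Nat.floor ((N : ℝ) / (16 * ρ ^ 2))

/-- The cube of side-length `m` with lower corner `z`. -/
def cube (d : ℕ) (m : ℕ) (z : ZVec d) : Set (ZVec d) :=
  {y | ∀ i, z i ≤ y i ∧ y i ≤ z i + m}

/-- The open cluster of `v` inside `U`. -/
def clusterIn (d : ℕ) (ω : Config d) (U : Set (ZVec d)) (v : ZVec d) : Set (ZVec d) :=
  {y | chemDistIn d ω U v y ≠ ⊤}

/-- `k ≤ r` for `k : ℕ∞` and `r : ℝ` (in particular `k` is finite). -/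
def chemLE (k : ℕ∞) (r : ℝ) : Prop := ∃ m : ℕ, k = (m : ℕ∞) ∧ (m : ℝ) ≤ r

/-- The box `Λ_{3N}(e)` is good (Definition 2.2 of the paper). -/
def GoodBox (d n : ℕ) (ρ Cstar : ℝ) (e : EdgeD d) (N : ℕ) (ω : Config d) : Prop :=
  (∃ v0 ∈ boxZ d (3 * N) e.val.1,
    (∀ z : ZVec d, cube d (Nrho ρ N) z ⊆ boxZ d (3 * N) e.val.1 →
      ∀ i : Fin d, ∃ γ, IsPath d γ ∧ IsOpenPath d ω γ ∧
        (∀ u ∈ γ, u ∈ clusterIn d ω (boxZ d (3 * N) e.val.1) v0 ∧ u ∈ cube d (Nrho ρ N) z) ∧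
        (∃ u ∈ γ, u i = z i) ∧ (∃ u ∈ γ, u i = z i + (Nrho ρ N : ℤ))) ∧
    (∀ π, IsPath d π → (∀ u ∈ π, u ∈ boxZ d (3 * N) e.val.1) →
      GstarIn d n ω (boxR d (Cstar * N) e.val.1) π → DiamGE d π ((Nrho ρ N : ℝ)) →
      ∃ u ∈ π, u ∈ clusterIn d ω (boxZ d (3 * N) e.val.1) v0)) ∧
  (∀ x y : ZVec d, x ∈ boxZ d (3 * N) e.val.1 → y ∈ boxZ d (3 * N) e.val.1 →
    normInf d (x - y) ≤ 2 * Nrho ρ N → chemDist d ω x y ≠ ⊤ →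
    chemDistIn d ω (boxZ d (4 * N) e.val.1) x y = chemDist d ω x y ∧
    chemLE (chemDist d ω x y) (4 * ρ * (Nrho ρ N : ℝ))) ∧
  (∀ x y : ZVec d, x ∈ annulus d N e → y ∈ annulus d N e →
    (∀ b : ZVec d, (normInf d (b - e.val.1) = N ∨ normInf d (b - e.val.1) = 3 * N) →
      (N : ℝ) / 2 ≤ (normInf d (x - b) : ℝ) ∧ (N : ℝ) / 2 ≤ (normInf d (y - b) : ℝ)) →
    normInf d (x - y) ≤ 2 * Nrho ρ N → chemDist d ω x y ≠ ⊤ →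
    chemDistIn d ω (annulus d N e) x y = chemDist d ω x y ∧
    chemLE (chemDist d ω x y) (4 * ρ * (Nrho ρ N : ℝ)))

/-- Evaluate an edge-indexed function at the (unordered) pair `{x,y}`, `0` if not an edge. -/
def edgeFnVal (d : ℕ) (g : EdgeD d → ℝ) (x y : ZVec d) : ℝ :=
  if h : ∃ e : EdgeD d, e.val = (x, y) ∨ e.val = (y, x) then g h.choose else 0

/-- The sum of `g` over the edges of the path `γ`. -/
def pathSum (d : ℕ) (g : EdgeD d → ℝ) (γ : List (ZVec d)) : ℝ :=
  ((γ.zip γ.tail).map fun pr => edgeFnVal d g pr.1 pr.2).sum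

/-- Number of edges of `η` that are not edges of `γ`, i.e. `|η \ γ|`. -/
def diffEdgeCount (d : ℕ) (η γ : List (ZVec d)) : ℕ :=
  ((η.zip η.tail).filter fun pr => decide (¬ edgeMemPath d pr.1 pr.2 γ)).length

/-- Maximal total weight of a lattice animal (path) in `Ξ_L`. -/
def animalMax (d : ℕ) (L : ℕ) (g : EdgeD d → ℝ) : ℝ :=
  sSup {r : ℝ | ∃ γ : List (ZVec d), IsPath d γ ∧ (∀ v ∈ γ, v ∈ boxZ d L 0) ∧
    γ.length ≤ L + 1 ∧ r = pathSum d g γ}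

/-- `m = ⌊n^{1/4}⌋`. -/
def mOf (n : ℕ) : ℕ := Nat.floor ((n : ℝ) ^ ((1 : ℝ) / 4))

/-- The box `Λ_m` as a finite set. -/
def boxFinset (d m : ℕ) : Finset (ZVec d) := Finset.Icc (fun _ => -(m : ℤ)) (fun _ => (m : ℤ))

/-- The spatially averaged passage time `F_m`. -/
def Fm (d n : ℕ) (ω : Config d) : ℝ :=
  (∑ z ∈ boxFinset d (mOf n), passageTime d n ω z (z + ptE1 d n)) / (boxFinset d (mOf n)).card

/-- The σ-algebra generated by the states of the first `i` edges. -/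
def edgeFiltration (d : ℕ) (ε : ℕ ≃ EdgeD d) (i : ℕ) : MeasurableSpace (Config d) :=
  MeasurableSpace.comap (fun ω (j : Fin i) => ω (ε j)) MeasurableSpace.pi

/-- The martingale increment `Δ_i = E[e^{λ F_m} | 𝓕_i] − E[e^{λ F_m} | 𝓕_{i−1}]`. -/
def mgDelta (d n : ℕ) (ε : ℕ ≃ EdgeD d) (lam : ℝ) (μ : Measure (Config d)) (i : ℕ) :
    Config d → ℝ :=
  fun ω => (μ[fun ω' => Real.exp (lam * Fm d n ω') | edgeFiltration d ε i]) ω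
    - (μ[fun ω' => Real.exp (lam * Fm d n ω') | edgeFiltration d ε (i - 1)]) ω

/-- The entropy `Ent[X] = E[X log (X / E[X])]`. -/
def entOf {α : Type*} [MeasurableSpace α] (μ : Measure α) (X : α → ℝ) : ℝ :=
  ∫ ω, X ω * Real.log (X ω / ∫ ω', X ω' ∂μ) ∂μ

end Perco
namespace Perco

/-- The nearest-neighbour graph on `ℤ^d`. -/
def lattice (d : ℕ) : SimpleGraph (ZVec d) where
  Adj := Adj d
  symm := ⟨fun x y h => by
    have : norm1 d (y - x) = norm1 d (x - y) := by
      unfold norm1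
      refine Finset.sum_congr rfl fun i _ => ?_
      simp only [Pi.sub_apply]; omega
    unfold Adj at *; rw [this]; exact h⟩
  loopless := ⟨fun x h => by simp [Adj, norm1] at h⟩

theorem normInf_le_iff {d : ℕ} {x : ZVec d} {k : ℕ} :
    normInf d x ≤ k ↔ ∀ i, (x i).natAbs ≤ k := by
  simp [normInf]

theorem natAbs_le_normInf {d : ℕ} (x : ZVec d) (i : Fin d) : (x i).natAbs ≤ normInf d x :=
  normInf_le_iff.1 le_rfl i

theorem normInf_le_norm1 {d : ℕ} (x : ZVec d) : normInf d x ≤ norm1 d x :=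
  normInf_le_iff.2 fun i =>
    Finset.single_le_sum (f := fun i => (x i).natAbs) (fun _ _ => Nat.zero_le _)
      (Finset.mem_univ i)

theorem norm1_le_mul_normInf {d : ℕ} (x : ZVec d) : norm1 d x ≤ d * normInf d x := by
  have := Finset.sum_le_card_nsmul Finset.univ (fun i => (x i).natAbs) (normInf d x)
    fun i _ => natAbs_le_normInf x i
  simpa [norm1] using this

theorem normInf_sub_le {d : ℕ} (x y z : ZVec d) :
    normInf d (x - z) ≤ normInf d (x - y) + normInf d (y - z) := by
  refine normInf_le_iff.2 fun i => ?_
  have h₁ := natAbs_le_normInf (x - y) i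
  have h₂ := natAbs_le_normInf (y - z) i
  simp only [Pi.sub_apply] at *
  omega

theorem normInf_sub_comm {d : ℕ} (x y : ZVec d) : normInf d (x - y) = normInf d (y - x) := by
  unfold normInf
  refine Finset.sup_congr rfl fun i _ => ?_
  simp only [Pi.sub_apply]; omega

theorem finite_box {d : ℕ} (c : ZVec d) (k : ℕ) : {y | normInf d (y - c) ≤ k}.Finite := by
  refine (Set.finite_Icc (fun i => c i - (k : ℤ)) (fun i => c i + (k : ℤ))).subset fun y hy => ?_
  have h := normInf_le_iff.1 hy
  refine ⟨fun i => ?_, fun i => ?_⟩ <;>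
  · have := h i
    simp only [Pi.sub_apply] at *
    omega

theorem normInf_sub_le_of_adj {d : ℕ} {x y : ZVec d} (h : (lattice d).Adj x y) (c : ZVec d) :
    normInf d (x - c) ≤ normInf d (y - c) + 1 := by
  have h₁ := normInf_sub_le x y c
  have h₂ := normInf_le_norm1 (x - y)
  have h₃ : norm1 d (x - y) = 1 := h
  omega

theorem normInf_sub_le_add_length {d : ℕ} {x y : ZVec d} (w : (lattice d).Walk x y) (c : ZVec d) :
    normInf d (x - c) ≤ normInf d (y - c) + w.length := by
  induction w with
  | nil => simp
  | cons h p ih =>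
    have := normInf_sub_le_of_adj h c
    simp only [SimpleGraph.Walk.length_cons]
    omega

theorem norm1_ne_of_adj {d : ℕ} {x y : ZVec d} (h : (lattice d).Adj x y) :
    norm1 d x ≠ norm1 d y := by
  have key : ∀ z : ZVec d, ((norm1 d z : ℕ) : ZMod 2) = ∑ i, ((z i : ℤ) : ZMod 2) := by
    intro z
    rw [norm1, Nat.cast_sum]
    refine Finset.sum_congr rfl fun i _ => ?_
    rcases Int.natAbs_eq (z i) with hz | hz
    · conv_rhs => rw [hz]
      simp
    · conv_rhs => rw [hz]
      simp
  intro he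
  have h₁ : norm1 d (x - y) = 1 := h
  have h₂ := key (x - y)
  rw [h₁] at h₂
  simp only [Pi.sub_apply, Int.cast_sub, Finset.sum_sub_distrib] at h₂
  rw [← key, ← key, he, sub_self] at h₂
  simp at h₂

/-- There is a lattice walk of length `‖x - y‖₁` from `x` to `y`. -/
theorem exists_walk_length_eq_norm1 {d : ℕ} (x y : ZVec d) :
    ∃ w : (lattice d).Walk x y, w.length = norm1 d (x - y) := by
  induction hk : norm1 d (x - y) generalizing x with
  | zero =>
    have : x = y := by
      funext i
      have := (Finset.sum_eq_zero_iff.1 hk) i (Finset.mem_univ i)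
      simp only [Pi.sub_apply] at this
      omega
    subst this
    exact ⟨.nil, rfl⟩
  | succ k ih =>
    obtain ⟨i, hi⟩ : ∃ i, x i ≠ y i := by
      by_contra! hc
      have : x = y := funext hc
      subst this
      simp [norm1] at hk
    obtain ⟨s, hs, hs'⟩ : ∃ s : ℤ, s.natAbs = 1 ∧
        (x i - y i).natAbs = (x i + s - y i).natAbs + 1 := by
      rcases lt_or_gt_of_ne hi with h | h
      · exact ⟨1, rfl, by omega⟩
      · exact ⟨-1, rfl, by omega⟩
    have hadj : (lattice d).Adj x (Function.update x i (x i + s)) := by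
      change norm1 d _ = 1
      rw [norm1, Finset.sum_eq_single i]
      · simpa using hs
      · intro j _ hj
        simp [hj]
      · simp
    have hn : norm1 d (Function.update x i (x i + s) - y) = k := by
      rw [norm1, ← Finset.add_sum_erase _ _ (Finset.mem_univ i)] at hk ⊢
      have : ∑ j ∈ Finset.univ.erase i, ((Function.update x i (x i + s) - y) j).natAbs =
          ∑ j ∈ Finset.univ.erase i, ((x - y) j).natAbs := by
        refine Finset.sum_congr rfl fun j hj => ?_
        simp [Finset.ne_of_mem_erase hj]
      rw [this]
      simp only [Pi.sub_apply, Function.update_self] at hk ⊢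
      omega
    obtain ⟨w, hw⟩ := ih _ hn
    exact ⟨.cons hadj w, by simp [hw]⟩

/-- The unordered pair `z` is an open edge. -/
def OpenEdge {d : ℕ} (ω : Config d) (z : Sym2 (ZVec d)) : Prop :=
  ∃ e : EdgeD d, s(e.val.1, e.val.2) = z ∧ ω e = true

theorem edgeOpen_iff {d : ℕ} {ω : Config d} {x y : ZVec d} :
    EdgeOpen d ω x y ↔ OpenEdge ω s(x, y) := by
  unfold EdgeOpen OpenEdge
  simp only [Sym2.eq_iff, Prod.ext_iff]

theorem edgeD_ext {d : ℕ} {e f : EdgeD d}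
    (h : s(e.val.1, e.val.2) = s(f.val.1, f.val.2)) : e = f := by
  have he := e.property.2
  have hf := f.property.2
  rcases Sym2.eq_iff.1 h with ⟨h₁, h₂⟩ | ⟨h₁, h₂⟩
  · exact Subtype.ext (Prod.ext h₁ h₂)
  · rw [h₁, h₂] at he
    omega

theorem openEdge_edgeD {d : ℕ} {ω : Config d} {e : EdgeD d} :
    OpenEdge ω s(e.val.1, e.val.2) ↔ ω e = true := by
  constructor
  · rintro ⟨f, hf, hω⟩
    rwa [← edgeD_ext hf]
  · exact fun h => ⟨e, rfl, h⟩

theorem exists_edgeD {d : ℕ} {z : Sym2 (ZVec d)} (hz : z ∈ (lattice d).edgeSet) :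
    ∃ e : EdgeD d, s(e.val.1, e.val.2) = z := by
  induction z using Sym2.ind with
  | _ x y =>
    have h : (lattice d).Adj x y := hz
    rcases lt_or_gt_of_ne (norm1_ne_of_adj h) with hlt | hlt
    · exact ⟨⟨(x, y), h, hlt⟩, rfl⟩
    · exact ⟨⟨(y, x), h.symm, hlt⟩, Sym2.eq_swap⟩

/-- The truncated weight of an unordered pair. -/
def edgeWeight {d : ℕ} (n : ℕ) (ω : Config d) (z : Sym2 (ZVec d)) : ℝ :=
  if OpenEdge ω z then 1 else (Real.log n) ^ 2

theorem edgeWeight_nonneg {d : ℕ} (n : ℕ) (ω : Config d) (z : Sym2 (ZVec d)) :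
    0 ≤ edgeWeight n ω z := by
  unfold edgeWeight; split_ifs <;> positivity

/-- The truncated cost of a walk. -/
def walkCost {d : ℕ} (n : ℕ) (ω : Config d) {x y : ZVec d} (w : (lattice d).Walk x y) : ℝ :=
  (w.edges.map (edgeWeight n ω)).sum

theorem pathCost_support {d n : ℕ} {ω : Config d} {x y : ZVec d} (w : (lattice d).Walk x y) :
    pathCost d n ω w.support = walkCost n ω w := by
  induction w with
  | nil => simp [pathCost, walkCost]
  | cons h p ih =>
    rw [SimpleGraph.Walk.support_cons, ← SimpleGraph.Walk.cons_tail_support p, pathCost,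
      SimpleGraph.Walk.cons_tail_support p, ih]
    simp [walkCost, pairWeight, edgeWeight, edgeOpen_iff]

theorem isChain_support_iff {d : ℕ} {x y : ZVec d} (w : (lattice d).Walk x y)
    (S : ZVec d → ZVec d → Prop) (T : Sym2 (ZVec d) → Prop) (hST : ∀ a b, S a b ↔ T s(a, b)) :
    List.IsChain S w.support ↔ ∀ z ∈ w.edges, T z := by
  induction w with
  | nil => simp
  | cons h p ih =>
    rw [SimpleGraph.Walk.support_cons, ← SimpleGraph.Walk.cons_tail_support p,
      List.isChain_cons_cons, SimpleGraph.Walk.cons_tail_support p, ih]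
    simp [hST]

theorem isOpenPath_support {d : ℕ} {ω : Config d} {x y : ZVec d} (w : (lattice d).Walk x y) :
    IsOpenPath d ω w.support ↔ ∀ z ∈ w.edges, OpenEdge ω z :=
  isChain_support_iff w _ _ fun _ _ => edgeOpen_iff

theorem isPath_support {d : ℕ} {x y : ZVec d} (w : (lattice d).Walk x y) (h : w.IsPath) :
    IsPath d w.support := by
  refine ⟨w.support_ne_nil, h.support_nodup, ?_⟩
  exact SimpleGraph.Walk.isChain_adj_support w

theorem edgeMemPath_support {d : ℕ} {a b : ZVec d} (w : (lattice d).Walk a b) (x y : ZVec d) :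
    edgeMemPath d x y w.support ↔ s(x, y) ∈ w.edges := by
  induction w with
  | nil => simp [edgeMemPath]
  | cons h p ih =>
    rw [SimpleGraph.Walk.edges_cons, List.mem_cons, ← ih]
    unfold edgeMemPath
    rw [SimpleGraph.Walk.support_cons, List.tail_cons]
    conv_lhs => rw [← SimpleGraph.Walk.cons_tail_support p]
    rw [List.zip_cons_cons, List.mem_cons, List.mem_cons, Sym2.eq_iff,
      SimpleGraph.Walk.cons_tail_support p]
    simp only [Prod.mk.injEq]
    tauto

theorem head?_support {d : ℕ} {x y : ZVec d} (w : (lattice d).Walk x y) :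
    w.support.head? = some x := by
  rw [← SimpleGraph.Walk.cons_tail_support]; rfl

theorem getLast?_support {d : ℕ} {x y : ZVec d} (w : (lattice d).Walk x y) :
    w.support.getLast? = some y := by
  rw [List.getLast?_eq_getLast_of_ne_nil w.support_ne_nil, SimpleGraph.Walk.getLast_support]

theorem exists_walk_of_isChain {d : ℕ} {l : List (ZVec d)} {x y : ZVec d}
    (hc : List.IsChain (Adj d) l) (hx : l.head? = some x) (hy : l.getLast? = some y) :
    ∃ w : (lattice d).Walk x y, w.support = l := by
  induction l generalizing x with
  | nil => simp at hx
  | cons a t ih =>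
    obtain rfl : a = x := by simpa using hx
    cases t with
    | nil =>
      obtain rfl : a = y := by simpa using hy
      exact ⟨.nil, rfl⟩
    | cons b t =>
      rw [List.isChain_cons_cons] at hc
      obtain ⟨w, hw⟩ := ih hc.2 rfl (by simpa using hy)
      have hadj : (lattice d).Adj a b := hc.1
      exact ⟨.cons hadj w, by simp [hw]⟩

theorem IsPath.exists_walk {d : ℕ} {l : List (ZVec d)} {x y : ZVec d}
    (h : IsPath d l) (hx : l.head? = some x) (hy : l.getLast? = some y) :
    ∃ w : (lattice d).Walk x y, w.IsPath ∧ w.support = l := by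
  obtain ⟨w, hw⟩ := exists_walk_of_isChain h.2.2 hx hy
  exact ⟨w, SimpleGraph.Walk.isPath_def _ |>.2 (hw ▸ h.2.1), hw⟩

/-- A walk along which an integer function moves by at most one per step, and which reaches level
`k` from below, has an initial part that stays at or below `k` and ends at level `k`. -/
theorem exists_walk_first_hit {d : ℕ} (f : ZVec d → ℤ)
    (hf : ∀ x y, (lattice d).Adj x y → f y ≤ f x + 1) (k : ℤ) {a b : ZVec d}
    (W : (lattice d).Walk a b) (ha : f a ≤ k) (hk : ∃ z ∈ W.support, k ≤ f z) :
    ∃ (u : ZVec d) (P : (lattice d).Walk a u), f u = k ∧ (∀ z ∈ P.support, f z ≤ k) ∧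
      P.edges ⊆ W.edges ∧ P.support ⊆ W.support := by
  induction W with
  | nil =>
    obtain ⟨z, hz, hkz⟩ := hk
    simp only [SimpleGraph.Walk.support_nil, List.mem_singleton] at hz
    subst hz
    exact ⟨_, .nil, le_antisymm ha hkz, by simpa using ha, by simp, by simp⟩
  | @cons x y _ h p ih =>
    rcases eq_or_lt_of_le ha with he | hlt
    · exact ⟨_, .nil, he, by simpa using ha, by simp, by simp⟩
    · obtain ⟨z, hz, hkz⟩ := hk
      have hz' : z ∈ p.support := by
        rcases List.mem_cons.1 (SimpleGraph.Walk.support_cons h p ▸ hz) with rfl | hz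
        · omega
        · exact hz
      have hy : f y ≤ k := by have := hf x y h; omega
      obtain ⟨u, P, hu, hP, hE, hS⟩ := ih hy ⟨z, hz', hkz⟩
      refine ⟨u, .cons h P, hu, ?_, ?_, ?_⟩
      · simp only [SimpleGraph.Walk.support_cons, List.mem_cons, forall_eq_or_imp]
        exact ⟨ha, hP⟩
      · simpa using List.cons_subset_cons _ hE
      · simpa using List.cons_subset_cons _ hS

theorem exists_walk_first_ge {d : ℕ} (c : ZVec d) (k : ℕ) {a b : ZVec d}
    (W : (lattice d).Walk a b) (ha : normInf d (a - c) ≤ k)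
    (hk : ∃ z ∈ W.support, k ≤ normInf d (z - c)) :
    ∃ (u : ZVec d) (P : (lattice d).Walk a u), normInf d (u - c) = k ∧
      (∀ z ∈ P.support, normInf d (z - c) ≤ k) ∧ P.edges ⊆ W.edges ∧ P.support ⊆ W.support := by
  have := exists_walk_first_hit (fun z => (normInf d (z - c) : ℤ))
    (fun x y h => by have := normInf_sub_le_of_adj h.symm c; omega) k W (by exact_mod_cast ha)
    (by exact_mod_cast hk)
  exact_mod_cast this

theorem exists_walk_first_le {d : ℕ} (c : ZVec d) (k : ℕ) {a b : ZVec d}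
    (W : (lattice d).Walk a b) (ha : k ≤ normInf d (a - c))
    (hk : ∃ z ∈ W.support, normInf d (z - c) ≤ k) :
    ∃ (u : ZVec d) (P : (lattice d).Walk a u), normInf d (u - c) = k ∧
      (∀ z ∈ P.support, k ≤ normInf d (z - c)) ∧ P.edges ⊆ W.edges ∧ P.support ⊆ W.support := by
  have := exists_walk_first_hit (fun z => -(normInf d (z - c) : ℤ))
    (fun x y h => by have := normInf_sub_le_of_adj h c; omega) (-k) W (by omega)
    (by simpa using hk)
  simpa using this

/-- A walk from inside `Λ_{N+1}` that reaches distance `3N` contains a crossing of the annulus. -/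
theorem exists_crossing {d : ℕ} (c : ZVec d) {N : ℕ} (hN : 1 ≤ N) {a b : ZVec d}
    (Q : (lattice d).Walk a b) (ha : normInf d (a - c) ≤ N + 1)
    (hk : ∃ z ∈ Q.support, 3 * N ≤ normInf d (z - c)) :
    ∃ (x y : ZVec d) (σ : (lattice d).Walk x y), σ.IsPath ∧ normInf d (x - c) = 3 * N ∧
      normInf d (y - c) = N + 1 ∧
      (∀ z ∈ σ.support, normInf d (z - c) ≤ 3 * N ∧ N < normInf d (z - c)) ∧
      σ.edges ⊆ Q.edges ∧ σ.support ⊆ Q.support := by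
  obtain ⟨u, P, hu, hP, hE, hS⟩ := exists_walk_first_ge c (3 * N) Q (by omega) hk
  obtain ⟨v, R, hv, hR, hE', hS'⟩ := exists_walk_first_le c (N + 1) P.reverse (by omega)
    ⟨a, by simp, ha⟩
  have hE'' : R.edges ⊆ P.edges := fun z hz => by simpa using hE' hz
  have hS'' : R.support ⊆ P.support := fun z hz => by simpa using hS' hz
  refine ⟨u, v, R.bypass, R.bypass_isPath, hu, hv, fun z hz => ?_, ?_, ?_⟩
  · have hz := R.support_bypass_subset_support hz
    exact ⟨hP z (hS'' hz), hR z hz⟩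
  · exact fun z hz => hE (hE'' (R.edges_bypass_subset_edges hz))
  · exact fun z hz => hS (hS'' (R.support_bypass_subset_support hz))

theorem exists_subwalk {d : ℕ} {a b x y : ZVec d} (W : (lattice d).Walk a b)
    (hx : x ∈ W.support) (hy : y ∈ W.support) :
    ∃ P : (lattice d).Walk x y, P.edges ⊆ W.edges ∧ P.support ⊆ W.support := by
  refine ⟨(W.takeUntil x hx).reverse.append (W.takeUntil y hy), fun z hz => ?_, fun z hz => ?_⟩
  · simp only [SimpleGraph.Walk.edges_append, SimpleGraph.Walk.edges_reverse, List.mem_append,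
      List.mem_reverse] at hz
    rcases hz with hz | hz
    · exact W.edges_takeUntil_subset_edges hx hz
    · exact W.edges_takeUntil_subset_edges hy hz
  · simp only [SimpleGraph.Walk.mem_support_append_iff, SimpleGraph.Walk.support_reverse,
      List.mem_reverse] at hz
    rcases hz with hz | hz
    · exact W.support_takeUntil_subset_support hx hz
    · exact W.support_takeUntil_subset_support hy hz

theorem walkCost_append {d n : ℕ} {ω : Config d} {x y z : ZVec d} (p : (lattice d).Walk x y)
    (q : (lattice d).Walk y z) : walkCost n ω (p.append q) = walkCost n ω p + walkCost n ω q := by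
  simp [walkCost, SimpleGraph.Walk.edges_append]

theorem walkCost_eq_length {d n : ℕ} {ω : Config d} {x y : ZVec d} (w : (lattice d).Walk x y)
    (h : ∀ z ∈ w.edges, OpenEdge ω z) : walkCost n ω w = w.length := by
  have : w.edges.map (edgeWeight n ω) = w.edges.map fun _ => (1 : ℝ) :=
    List.map_congr_left fun z hz => by simp [edgeWeight, h z hz]
  rw [walkCost, this]
  simp

theorem walkCost_nonneg {d n : ℕ} {ω : Config d} {x y : ZVec d} (w : (lattice d).Walk x y) :
    0 ≤ walkCost n ω w := by
  refine List.sum_nonneg fun r hr => ?_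
  obtain ⟨z, -, rfl⟩ := List.mem_map.1 hr
  exact edgeWeight_nonneg n ω z

theorem walkCost_eq_sum {d n : ℕ} {ω : Config d} {x y : ZVec d} (w : (lattice d).Walk x y)
    (h : w.IsPath) : walkCost n ω w = ∑ z ∈ w.edges.toFinset, edgeWeight n ω z := by
  rw [walkCost, List.sum_toFinset _ h.isTrail.edges_nodup]

theorem walkCost_bypass_le {d n : ℕ} {ω : Config d} {x y : ZVec d} (w : (lattice d).Walk x y) :
    walkCost n ω w.bypass ≤ walkCost n ω w := by
  refine List.Sublist.sum_le_sum ((w.edges_bypass_sublist_edges).map _) fun r hr => ?_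
  obtain ⟨z, -, rfl⟩ := List.mem_map.1 hr
  exact edgeWeight_nonneg n ω z

theorem mul_length_le_walkCost {d n : ℕ} {ω : Config d} {x y : ZVec d} {m : ℝ}
    (w : (lattice d).Walk x y) (h : ∀ z, m ≤ edgeWeight n ω z) :
    m * w.length ≤ walkCost n ω w := by
  induction w with
  | nil => simp [walkCost]
  | @cons a b _ hab p ih =>
    simp only [walkCost, SimpleGraph.Walk.edges_cons, List.map_cons, List.sum_cons,
      SimpleGraph.Walk.length_cons, Nat.cast_add, Nat.cast_one] at ih ⊢
    have := h s(a, b)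
    linarith

theorem walkCost_le_length {d n : ℕ} {ω : Config d} {x y : ZVec d}
    (w : (lattice d).Walk x y) (h : ∀ z, edgeWeight n ω z ≤ 1) :
    walkCost n ω w ≤ w.length := by
  induction w with
  | nil => simp [walkCost]
  | @cons a b _ hab p ih =>
    simp only [walkCost, SimpleGraph.Walk.edges_cons, List.map_cons, List.sum_cons,
      SimpleGraph.Walk.length_cons, Nat.cast_add, Nat.cast_one] at ih ⊢
    have := h s(a, b)
    linarith

theorem mem_edges_iff_getVert {d : ℕ} {a b : ZVec d} (w : (lattice d).Walk a b)
    {z : Sym2 (ZVec d)} :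
    z ∈ w.edges ↔ ∃ m < w.length, s(w.getVert m, w.getVert (m + 1)) = z := by
  induction w with
  | nil => simp
  | cons h p ih =>
    rw [SimpleGraph.Walk.edges_cons, List.mem_cons, ih]
    constructor
    · rintro (rfl | ⟨m, hm, rfl⟩)
      · exact ⟨0, by simp, by simp⟩
      · exact ⟨m + 1, by simpa using hm, by simp⟩
    · rintro ⟨m, hm, rfl⟩
      cases m with
      | zero => left; simp
      | succ m => right; exact ⟨m, by simpa using hm, by simp⟩

/-- The segment between two indices of a walk of minimal cost is again of minimal cost. -/
theorem exists_segment {d n : ℕ} {ω : Config d} {a b : ZVec d} (γ : (lattice d).Walk a b)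
    (hγ : γ.IsPath) (hgeo : ∀ w : (lattice d).Walk a b, walkCost n ω γ ≤ walkCost n ω w)
    {i j : ℕ} (hij : i ≤ j) (hj : j ≤ γ.length) :
    ∃ q : (lattice d).Walk (γ.getVert i) (γ.getVert j), q.IsPath ∧ q.length = j - i ∧
      (∀ z ∈ q.support, ∃ m, i ≤ m ∧ m ≤ j ∧ γ.getVert m = z) ∧
      (∀ m, i ≤ m → m < j → s(γ.getVert m, γ.getVert (m + 1)) ∈ q.edges) ∧
      ∀ w : (lattice d).Walk (γ.getVert i) (γ.getVert j), walkCost n ω q ≤ walkCost n ω w := by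
  obtain ⟨v, hv, q, r, hqr, hl, hg⟩ : ∃ v, ∃ _ : γ.getVert j = v,
      ∃ (q : (lattice d).Walk (γ.getVert i) v) (r : (lattice d).Walk v b),
        γ = (γ.take i).append (q.append r) ∧ q.length = j - i ∧
        ∀ k ≤ j - i, q.getVert k = γ.getVert (i + k) := by
    refine ⟨(γ.drop i).getVert (j - i), ?_, (γ.drop i).take (j - i), (γ.drop i).drop (j - i),
      ?_, ?_, fun k hk => ?_⟩
    · rw [SimpleGraph.Walk.drop_getVert]; congr 1; omega
    · rw [SimpleGraph.Walk.append_take_drop_eq, SimpleGraph.Walk.append_take_drop_eq]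
    · rw [SimpleGraph.Walk.take_length, SimpleGraph.Walk.drop_length]; omega
    · rw [SimpleGraph.Walk.take_getVert, SimpleGraph.Walk.drop_getVert]; congr 1; omega
  subst hv
  refine ⟨q, ?_, hl, fun z hz => ?_, fun m him hmj => ?_, fun w => ?_⟩
  · rw [hqr] at hγ
    exact hγ.of_append_right.of_append_left
  · obtain ⟨k, rfl, hk⟩ := SimpleGraph.Walk.mem_support_iff_exists_getVert.1 hz
    exact ⟨i + k, by omega, by omega, (hg k (by omega)).symm⟩
  · rw [mem_edges_iff_getVert]
    refine ⟨m - i, by omega, ?_⟩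
    rw [hg _ (by omega), hg _ (by omega), show i + (m - i) = m by omega,
      show i + (m - i + 1) = m + 1 by omega]
  · have h₁ := hgeo ((γ.take i).append (w.append r))
    have h₂ : walkCost n ω γ = walkCost n ω ((γ.take i).append (q.append r)) := by rw [← hqr]
    rw [h₂] at h₁
    simp only [walkCost_append] at h₁
    linarith

theorem V2.exists_walk {d N : ℕ} {Cstar : ℝ} {e : EdgeD d} {ω : Config d}
    (hV2 : V2 d Cstar e N ω) {x y : ZVec d} (p : (lattice d).Walk x y)
    (hp : ∀ z ∈ p.edges, OpenEdge ω z) (hb : ∀ z ∈ p.support, normInf d (z - e.val.1) ≤ 3 * N) :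
    ∃ q : (lattice d).Walk x y, q.IsPath ∧ (∀ z ∈ q.edges, OpenEdge ω z) ∧
      (q.length : ℝ) ≤ Cstar * N := by
  obtain ⟨l, hl, hlo, -, hx, hy, hlen⟩ := hV2 x y (hb x p.start_mem_support)
    (hb y p.end_mem_support)
    ⟨p.bypass.support, isPath_support _ p.bypass_isPath,
      (isOpenPath_support _).2 fun z hz => hp z (p.edges_bypass_subset_edges hz),
      fun z hz => hb z (p.support_bypass_subset_support hz), head?_support _, getLast?_support _⟩
  obtain ⟨q, hq, rfl⟩ := hl.exists_walk hx hy
  refine ⟨q, hq, (isOpenPath_support q).1 hlo, ?_⟩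
  rw [SimpleGraph.Walk.length_support] at hlen
  push_cast at hlen
  linarith

/-- A walk from an earlier to a later vertex of `γ` which avoids the vertex of index `m` and uses
only edges of `γ` and open edges contains an open walk jumping over that vertex. -/
theorem exists_open_jump {d : ℕ} {ω : Config d} {a b : ZVec d} (γ : (lattice d).Walk a b)
    {m i j : ℕ} (hi : i < m) (hj : m < j) (hjl : j ≤ γ.length) {x y : ZVec d}
    (τ : (lattice d).Walk x y)
    (hx : γ.getVert i = x) (hy : γ.getVert j = y) (hm : γ.getVert m ∉ τ.support)
    (hE : ∀ z ∈ τ.edges, z ∈ γ.edges ∨ OpenEdge ω z) :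
    ∃ s t, s < m ∧ m < t ∧ t ≤ γ.length ∧
      ∃ p : (lattice d).Walk (γ.getVert s) (γ.getVert t),
        (∀ z ∈ p.edges, OpenEdge ω z) ∧ p.support ⊆ τ.support := by
  have key : (∃ s t, s < m ∧ m < t ∧ t ≤ γ.length ∧
      ∃ p : (lattice d).Walk (γ.getVert s) (γ.getVert t),
        (∀ z ∈ p.edges, OpenEdge ω z) ∧ p.support ⊆ τ.support) ∨
      ∃ t, m < t ∧ t ≤ γ.length ∧ ∃ p : (lattice d).Walk x (γ.getVert t),
        (∀ z ∈ p.edges, OpenEdge ω z) ∧ p.support ⊆ τ.support := by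
    clear hx
    induction τ with
    | nil => subst hy; exact .inr ⟨j, hj, hjl, .nil, by simp, by simp⟩
    | @cons u v _ h p ih =>
      rw [SimpleGraph.Walk.support_cons] at hm ⊢
      rw [List.mem_cons, not_or] at hm
      rcases ih hy hm.2 (fun z hz => hE z (by simp [hz])) with
        ⟨s, t, hs, ht, htl, q, hq, hqs⟩ | ⟨t, ht, htl, q, hq, hqs⟩
      · exact .inl ⟨s, t, hs, ht, htl, q, hq, fun z hz => List.mem_cons_of_mem _ (hqs hz)⟩
      by_cases ho : OpenEdge ω s(u, v)
      · refine .inr ⟨t, ht, htl, .cons h q, ?_, ?_⟩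
        · simpa using ⟨ho, hq⟩
        · simpa using List.cons_subset_cons _ hqs
      · have hγe := (hE s(u, v) (by simp)).resolve_right ho
        obtain ⟨k, hk, hkz⟩ := (mem_edges_iff_getVert γ).1 hγe
        have hv : γ.getVert m ≠ v := fun h => hm.2 (h ▸ p.start_mem_support)
        obtain ⟨k₁, k₂, hk₁, hk₂, rfl, rfl, hkk⟩ : ∃ k₁ k₂, k₁ ≤ γ.length ∧ k₂ ≤ γ.length ∧
            γ.getVert k₁ = u ∧ γ.getVert k₂ = v ∧ (k₂ = k₁ + 1 ∨ k₁ = k₂ + 1) := by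
          rcases Sym2.eq_iff.1 hkz with ⟨h₁, h₂⟩ | ⟨h₁, h₂⟩
          · exact ⟨k, k + 1, by omega, by omega, h₁, h₂, by omega⟩
          · exact ⟨k + 1, k, by omega, by omega, h₂, h₁, by omega⟩
        have hmk₁ : m ≠ k₁ := fun h => hm.1 (by rw [h])
        have hmk₂ : m ≠ k₂ := fun h => hv (by rw [h])
        rcases lt_or_gt_of_ne hmk₁ with h | h
        · exact .inr ⟨k₁, h, hk₁, .nil, by simp, by simp⟩
        · exact .inl ⟨k₂, t, by omega, ht, htl, q, hq,
            fun z hz => List.mem_cons_of_mem _ (hqs hz)⟩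
  rcases key with h | ⟨t, ht, htl, p, hp, hps⟩
  · exact h
  · subst hx
    exact ⟨i, t, hi, ht, htl, p, hp, hps⟩

/-- A walk of minimal cost between points of `Λ_{3N}(c)` joined by an open path of length at
most `C N` has length at most `2 (C - 3) N`. -/
theorem length_le_of_geodesic {d n N : ℕ} (hd : 2 ≤ d) (hn : 2 ≤ n) {C : ℝ}
    (hC : (100 : ℝ) ^ d ≤ C) {ω : Config d} {c x y : ZVec d} (q w : (lattice d).Walk x y)
    (hgeo : ∀ w : (lattice d).Walk x y, walkCost n ω q ≤ walkCost n ω w)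
    (hx : normInf d (x - c) ≤ 3 * N) (hy : normInf d (y - c) ≤ 3 * N)
    (hw : ∀ z ∈ w.edges, OpenEdge ω z) (hwl : (w.length : ℝ) ≤ C * N) :
    (q.length : ℝ) ≤ 2 * (C - 3) * N := by
  have hb : (1 : ℝ) + d * 99 ≤ 100 ^ d := by
    have := one_add_mul_le_pow (show (-2 : ℝ) ≤ 99 by norm_num) d
    norm_num at this
    exact this
  have hd' : (2 : ℝ) ≤ d := by exact_mod_cast hd
  have hN : (0 : ℝ) ≤ N := Nat.cast_nonneg N
  rcases eq_or_lt_of_le hn with rfl | hn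
  · have h2 := Real.log_two_gt_d9
    have h2' := Real.log_two_lt_d9
    push_cast at *
    obtain ⟨v, hv⟩ := exists_walk_length_eq_norm1 x y
    have h₁ := mul_length_le_walkCost (n := 2) (ω := ω) (m := 2 / 5) q fun z => by
      unfold edgeWeight; split_ifs <;> push_cast <;> nlinarith
    have h₂ := walkCost_le_length (n := 2) (ω := ω) v fun z => by
      unfold edgeWeight; split_ifs <;> push_cast <;> nlinarith
    have h₃ := hgeo v
    have h₄ := norm1_le_mul_normInf (x - y)
    have h₅ := normInf_sub_le x c y
    rw [normInf_sub_comm c y] at h₅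
    have h₆ : v.length ≤ d * (6 * N) := by
      rw [hv]; exact h₄.trans (Nat.mul_le_mul_left d (by omega))
    have h₇ : (v.length : ℝ) ≤ d * (6 * N) := by exact_mod_cast h₆
    have h₈ : 15 * d * (N : ℝ) ≤ 2 * (C - 3) * N :=
      mul_le_mul_of_nonneg_right (by linarith) hN
    linarith
  · have hlog : 1 ≤ Real.log n := by
      rw [Real.le_log_iff_exp_le (by positivity)]
      have := Real.exp_one_lt_d9
      have h3 : (3 : ℝ) ≤ n := by exact_mod_cast hn
      linarith
    have h₁ := mul_length_le_walkCost (n := n) (ω := ω) (m := 1) q fun z => by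
      unfold edgeWeight; split_ifs
      · exact le_rfl
      · nlinarith
    have h₂ := hgeo w
    rw [walkCost_eq_length w hw] at h₂
    have h₃ : C * N ≤ 2 * (C - 3) * N := mul_le_mul_of_nonneg_right (by linarith) hN
    linarith

/-- A path in `Λ_{3N}(e)` all of whose edges are open or belong to a path of minimal cost is a
modified geodesic of `Λ_{C N}(e)`. -/
theorem gstarIn_of_geodesic {d n N : ℕ} (hd : 2 ≤ d) (hn : 2 ≤ n) {Cstar : ℝ}
    (hC : (100 : ℝ) ^ d ≤ Cstar) {ω : Config d} {e : EdgeD d} (hV2 : V2 d Cstar e N ω)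
    {a b : ZVec d} (γ : (lattice d).Walk a b) (hγ : γ.IsPath)
    (hgeo : ∀ w : (lattice d).Walk a b, walkCost n ω γ ≤ walkCost n ω w)
    {x y : ZVec d} (σ : (lattice d).Walk x y) (hσ : σ.IsPath)
    (hbox : ∀ z ∈ σ.support, normInf d (z - e.val.1) ≤ 3 * N)
    (hE : ∀ z ∈ σ.edges, z ∈ γ.edges ∨ OpenEdge ω z) :
    GstarIn d n ω (boxR d (Cstar * N) e.val.1) σ.support := by
  have hN : (0 : ℝ) ≤ N := Nat.cast_nonneg N
  have hC100 : (100 : ℝ) ≤ Cstar := le_trans (le_self_pow₀ (by norm_num) (by omega)) hC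
  have hbox' : ∀ z, normInf d (z - e.val.1) ≤ 3 * N → z ∈ boxR d (Cstar * N) e.val.1 := by
    intro z hz
    have h₁ : (normInf d (z - e.val.1) : ℝ) ≤ 3 * N := by exact_mod_cast hz
    exact h₁.trans (mul_le_mul_of_nonneg_right (by linarith) hN)
  refine ⟨isPath_support σ hσ, fun v hv => hbox' v (hbox v hv), ?_⟩
  set I := (Finset.range (γ.length + 1)).filter fun m => γ.getVert m ∈ σ.support with hI
  have hImem : ∀ m, m ∈ I ↔ m ≤ γ.length ∧ γ.getVert m ∈ σ.support := by
    intro m; simp [hI]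
  have hIedge : ∀ u v, s(u, v) ∈ σ.edges → s(u, v) ∈ γ.edges →
      ∃ m, m ∈ I ∧ m + 1 ∈ I ∧ s(γ.getVert m, γ.getVert (m + 1)) = s(u, v) := by
    intro u v hσe hγe
    obtain ⟨m, hm, hz⟩ := (mem_edges_iff_getVert γ).1 hγe
    rw [← hz] at hσe
    exact ⟨m, (hImem _).2 ⟨hm.le, σ.fst_mem_support_of_mem_edges hσe⟩,
      (hImem _).2 ⟨hm, σ.snd_mem_support_of_mem_edges hσe⟩, hz⟩
  rcases I.eq_empty_or_nonempty with hemp | hne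
  · refine ⟨(SimpleGraph.Walk.nil : (lattice d).Walk x x).support, ⟨isPath_support _ .nil, ?_, ?_⟩,
      fun u v huv _ => ?_⟩
    · simpa using hbox' x (hbox x σ.start_mem_support)
    · intro π' hπ' _ hh hl
      rw [head?_support] at hh
      rw [getLast?_support] at hl
      obtain ⟨w, -, rfl⟩ := hπ'.exists_walk hh hl
      rw [pathCost_support, pathCost_support]
      simpa [walkCost] using walkCost_nonneg w
    · rw [edgeMemPath_support] at huv
      rw [edgeOpen_iff]
      refine (hE _ huv).resolve_left fun h => ?_
      obtain ⟨m, hm, -⟩ := hIedge u v huv h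
      simp [hemp] at hm
  · have h₀ := (hImem _).1 (I.min'_mem hne)
    have h₁ := (hImem _).1 (I.max'_mem hne)
    set i₀ := I.min' hne
    set i₁ := I.max' hne
    have hle : i₀ ≤ i₁ := I.min'_le_max' hne
    obtain ⟨q, hq, -, hqs, hqe, hqg⟩ := exists_segment γ hγ hgeo hle h₁.1
    refine ⟨q.support, ⟨isPath_support q hq, fun v hv => ?_, ?_⟩, fun u v huv hnot => ?_⟩
    · obtain ⟨m, hm₀, hm₁, rfl⟩ := hqs v hv
      by_cases hmb : normInf d (γ.getVert m - e.val.1) ≤ 3 * N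
      · exact hbox' _ hmb
      have hmσ : γ.getVert m ∉ σ.support := fun h => hmb (hbox _ h)
      have hne₀ : i₀ ≠ m := fun h => hmσ (h ▸ h₀.2)
      have hne₁ : m ≠ i₁ := fun h => hmσ (h ▸ h₁.2)
      obtain ⟨τ, hτe, hτs⟩ := exists_subwalk σ h₀.2 h₁.2
      obtain ⟨s, t, hs, ht, htl, p, hp, hps⟩ := exists_open_jump γ (lt_of_le_of_ne hm₀ hne₀)
        (lt_of_le_of_ne hm₁ hne₁) h₁.1 τ rfl rfl (fun h => hmσ (hτs h)) fun z hz => hE z (hτe hz)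
      have hpb : ∀ z ∈ p.support, normInf d (z - e.val.1) ≤ 3 * N :=
        fun z hz => hbox z (hτs (hps hz))
      obtain ⟨w, -, hw, hwl⟩ := hV2.exists_walk p hp hpb
      obtain ⟨q', -, hql, -, -, hqg'⟩ := exists_segment γ hγ hgeo (hs.trans ht).le htl
      have hlen := length_le_of_geodesic hd hn hC q' w hqg' (hpb _ p.start_mem_support)
        (hpb _ p.end_mem_support) hw hwl
      obtain ⟨q₁, -, hl₁, -⟩ := exists_segment γ hγ hgeo hs.le (ht.le.trans htl)
      obtain ⟨q₂, -, hl₂, -⟩ := exists_segment γ hγ hgeo ht.le htl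
      have e₁ := normInf_sub_le_add_length q₁.reverse e.val.1
      have e₂ := normInf_sub_le_add_length q₂ e.val.1
      rw [SimpleGraph.Walk.length_reverse] at e₁
      have b₁ := hpb _ p.start_mem_support
      have b₂ := hpb _ p.end_mem_support
      have hsum : 2 * normInf d (γ.getVert m - e.val.1) ≤ 6 * N + q'.length := by omega
      have hsum' : 2 * (normInf d (γ.getVert m - e.val.1) : ℝ) ≤ 6 * N + q'.length := by
        exact_mod_cast hsum
      change (normInf d (γ.getVert m - e.val.1) : ℝ) ≤ Cstar * N
      linarith
    · intro π' hπ' _ hh hl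
      rw [head?_support] at hh
      rw [getLast?_support] at hl
      obtain ⟨w, -, rfl⟩ := hπ'.exists_walk hh hl
      rw [pathCost_support, pathCost_support]
      exact hqg w
    · rw [edgeMemPath_support] at huv hnot
      rw [edgeOpen_iff]
      refine (hE _ huv).resolve_left fun h => hnot ?_
      obtain ⟨m, hm, hm', hz⟩ := hIedge u v huv h
      rw [← hz]
      exact hqe m (I.min'_le _ hm) (I.le_max' _ hm')

/-- If a walk from `a` visits `Λ_N(c)` and `a` is joined to the outside of `Λ_{3N}(c)` by open
edges, then the walk and the open edges contain a crossing of the annulus, each vertex of which is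
reached from `a` either along the walk outside of `Λ_N(c)`, or by an open walk in `Λ_{3N}(c)`. -/
theorem exists_accessible_crossing {d N : ℕ} (c : ZVec d) (hN : 1 ≤ N) {ω : Config d}
    {a b y : ZVec d} (W : (lattice d).Walk a b) (hW : ∃ z ∈ W.support, normInf d (z - c) ≤ N)
    (η : (lattice d).Walk a y) (hη : ∀ z ∈ η.edges, OpenEdge ω z)
    (hy : 3 * N < normInf d (y - c)) :
    ∃ (x y : ZVec d) (σ : (lattice d).Walk x y), σ.IsPath ∧ normInf d (x - c) = 3 * N ∧
      normInf d (y - c) = N + 1 ∧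
      (∀ z ∈ σ.support, normInf d (z - c) ≤ 3 * N ∧ N < normInf d (z - c)) ∧
      (∀ z ∈ σ.edges, z ∈ W.edges ∨ OpenEdge ω z) ∧
      ∀ z ∈ σ.support,
        (∃ P : (lattice d).Walk a z, ∀ f ∈ P.edges, f ∈ W.edges ∧ ∀ v ∈ f, N < normInf d (v - c)) ∨
        (normInf d (a - c) ≤ 3 * N ∧ ∃ p : (lattice d).Walk a z,
          (∀ f ∈ p.edges, OpenEdge ω f) ∧ ∀ v ∈ p.support, normInf d (v - c) ≤ 3 * N) := by
  have hη₀ : normInf d (a - c) ≤ 3 * N → ∃ (u : ZVec d) (η₀ : (lattice d).Walk a u),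
      normInf d (u - c) = 3 * N ∧ (∀ z ∈ η₀.edges, OpenEdge ω z) ∧
      ∀ z ∈ η₀.support, ∃ p : (lattice d).Walk a z,
          (∀ f ∈ p.edges, OpenEdge ω f) ∧ ∀ v ∈ p.support, normInf d (v - c) ≤ 3 * N := by
    intro ha
    obtain ⟨u, η₀, hu, hb, hE, -⟩ := exists_walk_first_ge c (3 * N) η ha
      ⟨y, η.end_mem_support, hy.le⟩
    exact ⟨u, η₀, hu, fun z hz => hη z (hE hz), fun z hz => ⟨η₀.takeUntil z hz,
      fun f hf => hη f (hE (η₀.edges_takeUntil_subset_edges hz hf)),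
      fun v hv => hb v (η₀.support_takeUntil_subset_support hz hv)⟩⟩
  rcases le_or_gt (normInf d (a - c)) N with haN | haN
  · obtain ⟨u, η₀, hu, hηo, hηp⟩ := hη₀ (by omega)
    obtain ⟨x, y, σ, hσ, hx, hy, han, hE, hS⟩ := exists_crossing c hN η₀ (by omega)
      ⟨u, η₀.end_mem_support, hu.ge⟩
    exact ⟨x, y, σ, hσ, hx, hy, han, fun z hz => .inr (hηo z (hE hz)),
      fun z hz => .inr ⟨by omega, hηp z (hS hz)⟩⟩
  obtain ⟨u, P, hu, hP, hPE, -⟩ := exists_walk_first_le c (N + 1) W haN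
    (hW.imp fun z hz => ⟨hz.1, by omega⟩)
  have hPacc : ∀ z ∈ P.support, ∃ P : (lattice d).Walk a z,
      ∀ f ∈ P.edges, f ∈ W.edges ∧ ∀ v ∈ f, N < normInf d (v - c) := fun z hz =>
    ⟨P.takeUntil z hz, fun f hf => by
      have hf' := P.edges_takeUntil_subset_edges hz hf
      exact ⟨hPE hf', fun v hv => hP v (P.mem_support_of_mem_edges hf' hv)⟩⟩
  by_cases hfar : ∃ z ∈ P.support, 3 * N ≤ normInf d (z - c)
  · obtain ⟨x, y, σ, hσ, hx, hy, han, hE, hS⟩ := exists_crossing c hN P.reverse (by omega)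
      (by simpa using hfar)
    exact ⟨x, y, σ, hσ, hx, hy, han, fun z hz => .inl (hPE (by simpa using hE hz)),
      fun z hz => .inl (hPacc z (by simpa using hS hz))⟩
  · push Not at hfar
    have ha := (hfar a P.start_mem_support).le
    obtain ⟨v, η₀, hv, hηo, hηp⟩ := hη₀ ha
    obtain ⟨x, y, σ, hσ, hx, hy, han, hE, hS⟩ := exists_crossing c hN (P.reverse.append η₀)
      (by omega) ⟨v, by simp, hv.ge⟩
    refine ⟨x, y, σ, hσ, hx, hy, han, fun z hz => ?_, fun z hz => ?_⟩
    · have := hE hz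
      simp only [SimpleGraph.Walk.edges_append, SimpleGraph.Walk.edges_reverse, List.mem_append,
        List.mem_reverse] at this
      exact this.imp (fun h => hPE h) (hηo z)
    · have := hS hz
      simp only [SimpleGraph.Walk.mem_support_append_iff, SimpleGraph.Walk.support_reverse,
        List.mem_reverse] at this
      exact this.imp (hPacc z) fun h => ⟨ha, hηp z h⟩

theorem V2.exists_walk_of_accessible {d N : ℕ} {Cstar : ℝ} (hC : 0 ≤ Cstar) {e : EdgeD d}
    {ω : Config d} (hV2 : V2 d Cstar e N ω) {a z : ZVec d} {E : List (Sym2 (ZVec d))}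
    (h : (∃ P : (lattice d).Walk a z, ∀ f ∈ P.edges, f ∈ E ∧
        ∀ v ∈ f, N < normInf d (v - e.val.1)) ∨
      (normInf d (a - e.val.1) ≤ 3 * N ∧ ∃ p : (lattice d).Walk a z,
        (∀ f ∈ p.edges, OpenEdge ω f) ∧ ∀ v ∈ p.support, normInf d (v - e.val.1) ≤ 3 * N)) :
    ∃ (P : (lattice d).Walk a z) (L : Finset (Sym2 (ZVec d))), (∀ f ∈ L, OpenEdge ω f) ∧
      (L.card : ℝ) ≤ (if normInf d (a - e.val.1) ≤ 3 * N then Cstar * N else 0) ∧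
      ∀ f ∈ P.edges, f ∈ L ∨ (f ∈ E ∧ ∀ v ∈ f, N < normInf d (v - e.val.1)) := by
  rcases h with ⟨P, hP⟩ | ⟨ha, p, hp, hb⟩
  · refine ⟨P, ∅, by simp, ?_, fun f hf => .inr (hP f hf)⟩
    split_ifs
    · simpa using by positivity
    · simp
  · obtain ⟨q, -, hq, hl⟩ := hV2.exists_walk p hp hb
    refine ⟨q, q.edges.toFinset, by simpa using hq, ?_, fun f hf => .inl (by simpa using hf)⟩
    rw [if_pos ha]
    refine le_trans ?_ hl
    exact_mod_cast (List.toFinset_card_le _).trans_eq q.length_edges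

/-- A walk made of geodesic edges and open edges that visits `Λ_N(e)` can be rerouted around
`Λ_N(e)` with the help of at most `2 C_* N` open edges. -/
theorem exists_detour {d n N : ℕ} (hd : 2 ≤ d) (hn : 2 ≤ n) (hN : 1 ≤ N) {Cstar : ℝ}
    (hC : (100 : ℝ) ^ d ≤ Cstar) {ω : Config d} {e : EdgeD d} (hV1 : V1 d Cstar n e N ω)
    (hV2 : V2 d Cstar e N ω) {a b : ZVec d} (γ : (lattice d).Walk a b) (hγ : γ.IsPath)
    (hgeo : ∀ w : (lattice d).Walk a b, walkCost n ω γ ≤ walkCost n ω w)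
    (W : (lattice d).Walk a b) (hE : ∀ z ∈ W.edges, z ∈ γ.edges ∨ OpenEdge ω z)
    (heW : s(e.val.1, e.val.2) ∈ W.edges)
    (hab : ¬ (normInf d (a - e.val.1) ≤ 3 * N ∧ normInf d (b - e.val.1) ≤ 3 * N))
    (ha : ∃ (y : ZVec d) (η : (lattice d).Walk a y), (∀ z ∈ η.edges, OpenEdge ω z) ∧
      3 * N < normInf d (y - e.val.1))
    (hb : ∃ (y : ZVec d) (η : (lattice d).Walk b y), (∀ z ∈ η.edges, OpenEdge ω z) ∧
      3 * N < normInf d (y - e.val.1)) :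
    ∃ (W' : (lattice d).Walk a b) (L : Finset (Sym2 (ZVec d))), (∀ f ∈ L, OpenEdge ω f) ∧
      (L.card : ℝ) ≤ 2 * Cstar * N ∧
      ∀ f ∈ W'.edges, f ∈ L ∨ (f ∈ W.edges ∧ ∀ v ∈ f, N < normInf d (v - e.val.1)) := by
  obtain ⟨ya, ηa, hηa, hya⟩ := ha
  obtain ⟨yb, ηb, hηb, hyb⟩ := hb
  have hC0 : 0 ≤ Cstar := le_trans (by positivity) hC
  have hmem : e.val.1 ∈ W.support := W.fst_mem_support_of_mem_edges heW
  have hr : normInf d (e.val.1 - e.val.1) ≤ N := by simp [normInf]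
  obtain ⟨x₁, y₁, σ₁, hσ₁, hx₁, hy₁, han₁, hE₁, hS₁⟩ :=
    exists_accessible_crossing e.val.1 hN W ⟨_, hmem, hr⟩ ηa hηa hya
  obtain ⟨x₂, y₂, σ₂, hσ₂, hx₂, hy₂, han₂, hE₂, hS₂⟩ :=
    exists_accessible_crossing e.val.1 hN W.reverse ⟨_, by simpa using hmem, hr⟩ ηb hηb hyb
  have hcross : ∀ {x y : ZVec d} (σ : (lattice d).Walk x y), σ.IsPath →
      normInf d (x - e.val.1) = 3 * N → normInf d (y - e.val.1) = N + 1 →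
      (∀ z ∈ σ.support, normInf d (z - e.val.1) ≤ 3 * N ∧ N < normInf d (z - e.val.1)) →
      (∀ z ∈ σ.edges, z ∈ W.edges ∨ OpenEdge ω z) →
      GstarIn d n ω (boxR d (Cstar * N) e.val.1) σ.support ∧ IsCrossing d N e σ.support :=
    fun σ hσ hx hy han hσE => ⟨gstarIn_of_geodesic hd hn hC hV2 γ hγ hgeo σ hσ
      (fun z hz => (han z hz).1) fun z hz => (hσE z hz).elim (hE z) .inr,
      isPath_support σ hσ, han, ⟨_, σ.end_mem_support, hy⟩, ⟨_, σ.start_mem_support, hx⟩⟩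
  obtain ⟨hG₁, hc₁⟩ := hcross σ₁ hσ₁ hx₁ hy₁ han₁ hE₁
  obtain ⟨hG₂, hc₂⟩ := hcross σ₂ hσ₂ hx₂ hy₂ han₂ (by simpa using hE₂)
  obtain ⟨π, hπ, hπo, -, ⟨u, hu, hu₁⟩, ⟨v, hv, hv₂⟩, hlen⟩ := hV1 _ _ hG₁ hc₁ hG₂ hc₂
  obtain ⟨M, -, rfl⟩ := hπ.exists_walk hu hv
  rw [isOpenPath_support] at hπo
  obtain ⟨P₁, L₁, hL₁, hl₁, hP₁⟩ := hV2.exists_walk_of_accessible hC0 (hS₁ u hu₁)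
  obtain ⟨P₂, L₂, hL₂, hl₂, hP₂⟩ := hV2.exists_walk_of_accessible hC0 (hS₂ v hv₂)
  refine ⟨P₁.append (M.append P₂.reverse), L₁ ∪ (M.edges.toFinset ∪ L₂), fun f hf => ?_, ?_,
    fun f hf => ?_⟩
  · simp only [Finset.mem_union, List.mem_toFinset] at hf
    rcases hf with hf | hf | hf
    exacts [hL₁ f hf, hπo f hf, hL₂ f hf]
  · have h₁ : (L₁ ∪ (M.edges.toFinset ∪ L₂)).card ≤ L₁.card + (M.length + L₂.card) := by
      refine (Finset.card_union_le _ _).trans (Nat.add_le_add_left ?_ _)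
      refine (Finset.card_union_le _ _).trans (Nat.add_le_add_right ?_ _)
      exact (List.toFinset_card_le _).trans_eq M.length_edges
    have h₂ : ((L₁ ∪ (M.edges.toFinset ∪ L₂)).card : ℝ) ≤ L₁.card + (M.length + L₂.card) := by
      exact_mod_cast h₁
    rw [SimpleGraph.Walk.length_support] at hlen
    push_cast at hlen
    have h₃ : 0 ≤ Cstar * N := by positivity
    split_ifs at hl₁ hl₂ with h h'
    · exact absurd ⟨h, h'⟩ hab
    all_goals linarith
  · simp only [SimpleGraph.Walk.edges_append, SimpleGraph.Walk.edges_reverse, List.mem_append,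
      List.mem_reverse] at hf
    simp only [Finset.mem_union, List.mem_toFinset]
    rcases hf with hf | hf | hf
    · exact (hP₁ f hf).imp_left .inl
    · exact .inl (.inr (.inl hf))
    · exact (hP₂ f hf).imp (fun h => .inr (.inr h)) fun h => by simpa using h

theorem exists_effectiveRadius {d n : ℕ} {Cstar : ℝ} {e : EdgeD d} {ω : Config d}
    (h : ReffENN d Cstar n e ω ≠ ⊤) :
    ∃ N : ℕ, ReffENN d Cstar n e ω = N ∧ 1 ≤ N ∧ V1 d Cstar n e N ω ∧ V2 d Cstar e N ω := by
  have hne : {N : ℕ | 1 ≤ N ∧ V1 d Cstar n e N ω ∧ V2 d Cstar e N ω}.Nonempty := by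
    by_contra hemp
    rw [Set.not_nonempty_iff_eq_empty, Set.eq_empty_iff_forall_notMem] at hemp
    refine h (sInf_eq_top.2 ?_)
    rintro _ ⟨N, -, hN⟩
    exact absurd hN (hemp N)
  refine ⟨sInf _, le_antisymm (sInf_le ⟨_, rfl, Nat.sInf_mem hne⟩) (le_sInf ?_),
    Nat.sInf_mem hne⟩
  rintro _ ⟨N, rfl, hN⟩
  exact_mod_cast Nat.sInf_le hN

theorem exists_walk_of_chemDist_ne_top {d : ℕ} {ω : Config d} {x y : ZVec d}
    (h : chemDist d ω x y ≠ ⊤) :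
    ∃ w : (lattice d).Walk x y, (∀ z ∈ w.edges, OpenEdge ω z) ∧
      (w.length : ℕ∞) = chemDist d ω x y := by
  have hne : {k : ℕ∞ | ∃ γ : List (ZVec d), IsPath d γ ∧ IsOpenPath d ω γ ∧
      (∀ v ∈ γ, v ∈ Set.univ) ∧ γ.head? = some x ∧ γ.getLast? = some y ∧
      ((γ.length - 1 : ℕ) : ℕ∞) = k}.Nonempty := by
    by_contra hemp
    rw [Set.not_nonempty_iff_eq_empty] at hemp
    refine h ?_
    rw [chemDist, chemDistIn, hemp, sInf_empty]
  obtain ⟨l, hl, ho, -, hx, hy, hlen⟩ := csInf_mem hne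
  obtain ⟨w, -, rfl⟩ := hl.exists_walk hx hy
  refine ⟨w, (isOpenPath_support w).1 ho, ?_⟩
  rw [chemDist, chemDistIn, ← hlen]
  simp

theorem chemDist_le_length {d : ℕ} {ω : Config d} {x y : ZVec d} (w : (lattice d).Walk x y)
    (hw : w.IsPath) (ho : ∀ z ∈ w.edges, OpenEdge ω z) : chemDist d ω x y ≤ w.length :=
  sInf_le ⟨w.support, isPath_support w hw, (isOpenPath_support w).2 ho, fun _ _ => trivial,
    head?_support w, getLast?_support w, by simp⟩

theorem InInfCluster.exists_walk {d : ℕ} {ω : Config d} {a : ZVec d} (h : InInfCluster d ω a)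
    (c : ZVec d) (k : ℕ) : ∃ (y : ZVec d) (η : (lattice d).Walk a y),
      (∀ z ∈ η.edges, OpenEdge ω z) ∧ k < normInf d (y - c) := by
  obtain ⟨y, hy, hy'⟩ := (h.sdiff (finite_box c k)).nonempty
  obtain ⟨η, hη, -⟩ := exists_walk_of_chemDist_ne_top hy
  exact ⟨y, η, hη, not_le.1 hy'⟩

theorem log_sq_le_of_detour {d n : ℕ} {ω : Config d} {a b : ZVec d} (γ W : (lattice d).Walk a b)
    (hγ : γ.IsPath) (hgeo : ∀ w : (lattice d).Walk a b, walkCost n ω γ ≤ walkCost n ω w)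
    {z : Sym2 (ZVec d)} (hz : z ∈ γ.edges) (hzo : ¬ OpenEdge ω z) (L : Finset (Sym2 (ZVec d)))
    (hL : ∀ f ∈ L, OpenEdge ω f) (hW : ∀ f ∈ W.edges, f ∈ L ∨ (f ∈ γ.edges ∧ f ≠ z)) :
    (Real.log n) ^ 2 ≤ L.card := by
  have h₁ := hgeo W.bypass
  rw [walkCost_eq_sum _ hγ, walkCost_eq_sum _ W.bypass_isPath] at h₁
  have hsub : W.bypass.edges.toFinset ⊆ L ∪ γ.edges.toFinset.erase z := by
    intro f hf
    have := hW f (W.edges_bypass_subset_edges (List.mem_toFinset.1 hf))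
    simp only [Finset.mem_union, Finset.mem_erase, List.mem_toFinset]
    tauto
  have h₂ := Finset.sum_le_sum_of_subset_of_nonneg (f := edgeWeight n ω) hsub
    fun f _ _ => edgeWeight_nonneg n ω f
  have h₃ : ∑ f ∈ L ∪ γ.edges.toFinset.erase z, edgeWeight n ω f ≤
      ∑ f ∈ L, edgeWeight n ω f + ∑ f ∈ γ.edges.toFinset.erase z, edgeWeight n ω f := by
    rw [← Finset.sum_union_inter]
    exact le_add_of_nonneg_right (Finset.sum_nonneg fun f _ => edgeWeight_nonneg n ω f)
  have h₄ : ∑ f ∈ L, edgeWeight n ω f = L.card := by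
    rw [Finset.sum_congr rfl fun f hf => show edgeWeight n ω f = 1 by
      simp [edgeWeight, hL f hf]]
    simp
  have h₅ := Finset.add_sum_erase γ.edges.toFinset (edgeWeight n ω) (List.mem_toFinset.2 hz)
  have h₆ : edgeWeight n ω z = (Real.log n) ^ 2 := by simp [edgeWeight, hzo]
  linarith

theorem card_open_le_walkCost {d n : ℕ} {ω : Config d} {a b : ZVec d} (γ : (lattice d).Walk a b)
    (hγ : γ.IsPath) :
    ((γ.edges.toFinset.filter (OpenEdge ω)).card : ℝ) ≤ walkCost n ω γ := by
  rw [walkCost_eq_sum _ hγ]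
  calc ((γ.edges.toFinset.filter (OpenEdge ω)).card : ℝ)
      = ∑ z ∈ γ.edges.toFinset.filter (OpenEdge ω), edgeWeight n ω z := by
        rw [Finset.sum_congr rfl fun f hf => show edgeWeight n ω f = 1 by
          simp [edgeWeight, (Finset.mem_filter.1 hf).2]]
        simp
    _ ≤ _ := Finset.sum_le_sum_of_subset_of_nonneg (Finset.filter_subset _ _)
        fun f _ _ => edgeWeight_nonneg n ω f

/-- Removing the closed edges of a walk by successive detours, in order of decreasing radius,
selects well-separated closed edges whose radii bound the number of additional open edges. -/
theorem exists_separated_detours {d : ℕ} {ω : Config d} {a b : ZVec d} {K : ℝ}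
    (R : Sym2 (ZVec d) → ℕ) (E : List (Sym2 (ZVec d)))
    (hdet : ∀ e : EdgeD d, ω e = false → ∀ W : (lattice d).Walk a b,
      (∀ z ∈ W.edges, z ∈ E ∨ OpenEdge ω z) → s(e.val.1, e.val.2) ∈ W.edges →
      ∃ (W' : (lattice d).Walk a b) (L : Finset (Sym2 (ZVec d))), (∀ f ∈ L, OpenEdge ω f) ∧
        (L.card : ℝ) ≤ K * R s(e.val.1, e.val.2) ∧ ∀ f ∈ W'.edges, f ∈ L ∨
          (f ∈ W.edges ∧ ∀ v ∈ f, R s(e.val.1, e.val.2) < normInf d (v - e.val.1)))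
    (W : (lattice d).Walk a b) (hW : ∀ z ∈ W.edges, z ∈ E ∨ OpenEdge ω z) :
    ∃ Γ : Finset (EdgeD d), (∀ e ∈ Γ, s(e.val.1, e.val.2) ∈ W.edges ∧ ω e = false) ∧
      (∀ e ∈ Γ, ∀ e' ∈ Γ, e ≠ e' → max (R s(e.val.1, e.val.2)) (R s(e'.val.1, e'.val.2)) ≤
        normInf d (e.val.1 - e'.val.1)) ∧
      ∃ W' : (lattice d).Walk a b, (∀ z ∈ W'.edges, OpenEdge ω z) ∧
        (W'.edges.toFinset.card : ℝ) ≤ (W.edges.toFinset.filter (OpenEdge ω)).card +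
          ∑ e ∈ Γ, K * R s(e.val.1, e.val.2) := by
  induction hk : (W.edges.toFinset.filter fun z => ¬ OpenEdge ω z).card using
    Nat.strong_induction_on generalizing W with
  | _ k ih =>
    rcases (W.edges.toFinset.filter fun z => ¬ OpenEdge ω z).eq_empty_or_nonempty with hemp | hne
    · have ho : ∀ z ∈ W.edges, OpenEdge ω z := by
        simpa [Finset.filter_eq_empty_iff] using hemp
      refine ⟨∅, by simp, by simp, W, ho, ?_⟩
      rw [Finset.filter_true_of_mem (by simpa using ho)]
      simp
    obtain ⟨z, hz, hmax⟩ := Finset.exists_max_image _ R hne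
    rw [Finset.mem_filter, List.mem_toFinset] at hz
    obtain ⟨e, rfl⟩ := exists_edgeD (W.edges_subset_edgeSet hz.1)
    have hωe : ω e = false := by simpa [openEdge_edgeD] using hz.2
    obtain ⟨W₁, L, hL, hLc, hW₁⟩ := hdet e hωe W hW hz.1
    have hself : normInf d (e.val.1 - e.val.1) = 0 := by simp [normInf]
    have hW₁' : ∀ f ∈ W₁.edges, ¬ OpenEdge ω f → f ∈ W.edges ∧
        ∀ v ∈ f, R s(e.val.1, e.val.2) < normInf d (v - e.val.1) :=
      fun f hf hfo => (hW₁ f hf).resolve_left fun h => hfo (hL f h)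
    have hlt : (W₁.edges.toFinset.filter fun z => ¬ OpenEdge ω z).card < k := by
      rw [← hk]
      refine Finset.card_lt_card ((Finset.ssubset_iff_of_subset fun f hf => ?_).2
        ⟨s(e.val.1, e.val.2), by simpa using hz, fun h => ?_⟩)
      · simp only [Finset.mem_filter, List.mem_toFinset] at hf ⊢
        exact ⟨(hW₁' f hf.1 hf.2).1, hf.2⟩
      · simp only [Finset.mem_filter, List.mem_toFinset] at h
        have := (hW₁' _ h.1 h.2).2 e.val.1 (Sym2.mem_mk_left _ _)
        omega
    obtain ⟨Γ, hΓ, hsep, W₂, ho, hc⟩ := ih _ hlt W₁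
      (fun f hf => (hW₁ f hf).elim (fun h => .inr (hL f h)) fun h => hW f h.1) rfl
    have hΓ' : ∀ f ∈ Γ, (s(f.val.1, f.val.2) ∈ W.edges ∧ ω f = false) ∧
        max (R s(e.val.1, e.val.2)) (R s(f.val.1, f.val.2)) ≤
          normInf d (f.val.1 - e.val.1) ∧ f ≠ e := by
      intro f hf
      have hfo : ¬ OpenEdge ω s(f.val.1, f.val.2) := by simp [openEdge_edgeD, (hΓ f hf).2]
      obtain ⟨h₁, h₂⟩ := hW₁' _ (hΓ f hf).1 hfo
      have h₃ := h₂ f.val.1 (Sym2.mem_mk_left _ _)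
      have h₄ := hmax _ (Finset.mem_filter.2 ⟨List.mem_toFinset.2 h₁, hfo⟩)
      refine ⟨⟨h₁, (hΓ f hf).2⟩, by omega, ?_⟩
      rintro rfl
      omega
    refine ⟨insert e Γ, ?_, ?_, W₂, ho, ?_⟩
    · simp only [Finset.forall_mem_insert]
      exact ⟨⟨hz.1, hωe⟩, fun f hf => (hΓ' f hf).1⟩
    · intro f hf f' hf' hff
      rw [Finset.mem_insert] at hf hf'
      rcases hf with rfl | hf <;> rcases hf' with rfl | hf'
      · exact absurd rfl hff
      · rw [normInf_sub_comm]
        exact (hΓ' f' hf').2.1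
      · rw [max_comm]
        exact (hΓ' f hf).2.1
      · exact hsep f hf f' hf' hff
    · rw [Finset.sum_insert fun h => (hΓ' e h).2.2 rfl]
      have h₁ : (W₁.edges.toFinset.filter (OpenEdge ω)).card ≤
          L.card + (W.edges.toFinset.filter (OpenEdge ω)).card := by
        refine le_trans (Finset.card_le_card fun f hf => ?_) (Finset.card_union_le _ _)
        simp only [Finset.mem_union, Finset.mem_filter, List.mem_toFinset] at hf ⊢
        exact (hW₁ f hf.1).imp_right fun h => ⟨h.1, hf.2⟩
      have h₂ : ((W₁.edges.toFinset.filter (OpenEdge ω)).card : ℝ) ≤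
          L.card + (W.edges.toFinset.filter (OpenEdge ω)).card := by exact_mod_cast h₁
      linarith

/-- Proposition 5.1: covering of closed edges on a geodesic.
Let `γ` be a geodesic of `T(0*, (n e₁)*)`, and suppose `{0*, (n e₁)*} ⊄ Λ_{3R_e}(e)`
for every closed edge `e` of `γ`.  Then (i) every closed edge `e` of `γ` satisfies
`R_e ≥ log² n / (2C_*)`, and (ii) there is `Γ ⊆ clo(γ)` with (iia) `‖e − e'‖_∞ ≥
max{R_e, R_{e'}}` for distinct `e, e' ∈ Γ` and (iib)
`|D*_n − T(0*, (n e₁)*)| ≤ 2 C_* Σ_{e∈Γ} R_e`. -/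
theorem covering_closed_edges_on_geodesic
    (d n : ℕ) (hd : 2 ≤ d) (hn : 2 ≤ n)
    (ρ cs Cstar : ℝ) (hρ : 1 ≤ ρ) (hcs0 : 0 < cs) (hcs1 : cs < 1)
    (hC : Cstar = 1 / cs + (100 * ρ ^ 2) ^ d)
    (ω : Config d)
    (h0 : InInfCluster d ω (starPt d ω 0))
    (h1 : InInfCluster d ω (starPt d ω (ptE1 d n)))
    (γ : List (ZVec d)) (hγ : IsGeodesicIn d n ω Set.univ γ)
    (hhead : γ.head? = some (starPt d ω 0))
    (hlast : γ.getLast? = some (starPt d ω (ptE1 d n)))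
    (hsep : ∀ e : EdgeD d, edgeMemPath d e.val.1 e.val.2 γ → ω e = false →
      ¬ (((normInf d (starPt d ω 0 - e.val.1) : ℕ) : ℝ≥0∞) ≤ 3 * ReffENN d Cstar n e ω ∧
         ((normInf d (starPt d ω (ptE1 d n) - e.val.1) : ℕ) : ℝ≥0∞)
            ≤ 3 * ReffENN d Cstar n e ω)) :
    -- (i)
    (∀ e : EdgeD d, edgeMemPath d e.val.1 e.val.2 γ → ω e = false →
      ENNReal.ofReal ((Real.log n) ^ 2 / (2 * Cstar)) ≤ ReffENN d Cstar n e ω) ∧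
    -- (ii)
    ∃ Γ : Finset (EdgeD d),
      (∀ e ∈ Γ, edgeMemPath d e.val.1 e.val.2 γ ∧ ω e = false) ∧
      -- (iia)
      (∀ e ∈ Γ, ∀ e' ∈ Γ, e ≠ e' →
        max ((ReffENN d Cstar n e ω).toReal) ((ReffENN d Cstar n e' ω).toReal)
          ≤ (normInf d (e.val.1 - e'.val.1) : ℝ)) ∧
      -- (iib)
      |DstarR d n ω -
          passageTime d n ω (starPt d ω 0) (starPt d ω (ptE1 d n))|
        ≤ 2 * Cstar * ∑ e ∈ Γ, (ReffENN d Cstar n e ω).toReal := by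
  set a := starPt d ω 0
  set b := starPt d ω (ptE1 d n)
  obtain ⟨g, hg, rfl⟩ := hγ.1.exists_walk hhead hlast
  have hgeo' : ∀ w : (lattice d).Walk a b, w.IsPath → walkCost n ω g ≤ walkCost n ω w := by
    intro w hw
    rw [← pathCost_support, ← pathCost_support]
    exact hγ.2.2 _ (isPath_support w hw) (fun _ _ => trivial)
      (by rw [head?_support, head?_support]) (by rw [getLast?_support, getLast?_support])
  have hgeo : ∀ w : (lattice d).Walk a b, walkCost n ω g ≤ walkCost n ω w :=
    fun w => (hgeo' _ w.bypass_isPath).trans (walkCost_bypass_le w)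
  have hC100 : (100 : ℝ) ^ d ≤ Cstar := by
    have h₁ : (100 : ℝ) ^ d ≤ (100 * ρ ^ 2) ^ d :=
      pow_le_pow_left₀ (by norm_num) (by nlinarith) d
    have h₂ : 0 < 1 / cs := by positivity
    linarith
  have hC0 : 0 < Cstar := lt_of_lt_of_le (by positivity) hC100
  simp only [edgeMemPath_support] at hsep ⊢
  have hR : ∀ e : EdgeD d, s(e.val.1, e.val.2) ∈ g.edges → ω e = false →
      ∃ N : ℕ, ReffENN d Cstar n e ω = N ∧ 1 ≤ N ∧ V1 d Cstar n e N ω ∧ V2 d Cstar e N ω ∧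
        ¬ (normInf d (a - e.val.1) ≤ 3 * N ∧ normInf d (b - e.val.1) ≤ 3 * N) := by
    intro e he hω
    have hs := hsep e he hω
    obtain ⟨N, hN, hN1, hV1, hV2⟩ := exists_effectiveRadius
      (show ReffENN d Cstar n e ω ≠ ⊤ from fun h => hs (by simp [h, ENNReal.mul_top]))
    rw [hN] at hs
    exact ⟨N, hN, hN1, hV1, hV2, by exact_mod_cast hs⟩
  obtain ⟨R, hR'⟩ : ∃ R : Sym2 (ZVec d) → ℕ, ∀ e : EdgeD d, s(e.val.1, e.val.2) ∈ g.edges →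
      ω e = false → ReffENN d Cstar n e ω = R s(e.val.1, e.val.2) := by
    have hz : ∀ z : Sym2 (ZVec d), ∃ N : ℕ, ∀ e : EdgeD d, s(e.val.1, e.val.2) = z →
        s(e.val.1, e.val.2) ∈ g.edges → ω e = false → ReffENN d Cstar n e ω = N := by
      intro z
      by_cases h : ∃ e : EdgeD d, s(e.val.1, e.val.2) = z ∧ s(e.val.1, e.val.2) ∈ g.edges ∧
          ω e = false
      · obtain ⟨e, rfl, he, hω⟩ := h
        obtain ⟨N, hN, -⟩ := hR e he hω
        exact ⟨N, fun f hf _ _ => edgeD_ext hf ▸ hN⟩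
      · exact ⟨0, fun e hez he hω => absurd ⟨e, hez, he, hω⟩ h⟩
    choose R hR' using hz
    exact ⟨R, fun e => hR' _ e rfl⟩
  have hdet : ∀ e : EdgeD d, ω e = false → ∀ W : (lattice d).Walk a b,
      (∀ z ∈ W.edges, z ∈ g.edges ∨ OpenEdge ω z) → s(e.val.1, e.val.2) ∈ W.edges →
      ∃ (W' : (lattice d).Walk a b) (L : Finset (Sym2 (ZVec d))), (∀ f ∈ L, OpenEdge ω f) ∧
        (L.card : ℝ) ≤ 2 * Cstar * R s(e.val.1, e.val.2) ∧ ∀ f ∈ W'.edges, f ∈ L ∨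
          (f ∈ W.edges ∧ ∀ v ∈ f, R s(e.val.1, e.val.2) < normInf d (v - e.val.1)) := by
    intro e hω W hW he
    have heg : s(e.val.1, e.val.2) ∈ g.edges :=
      (hW _ he).resolve_right (by simp [openEdge_edgeD, hω])
    obtain ⟨N, hN, hN1, hV1, hV2, hab⟩ := hR e heg hω
    obtain rfl : N = R s(e.val.1, e.val.2) := by
      have := hR' e heg hω
      rw [hN] at this
      exact_mod_cast this
    exact exists_detour hd hn hN1 hC100 hV1 hV2 g hg hgeo W hW he hab (h0.exists_walk _ _)
      (h1.exists_walk _ _)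
  refine ⟨fun e he hω => ?_, ?_⟩
  · obtain ⟨W, L, hL, hLc, hW⟩ := hdet e hω g (fun _ h => .inl h) he
    have hlog := log_sq_le_of_detour g W hg hgeo he (by simp [openEdge_edgeD, hω]) L hL
      fun f hf => (hW f hf).imp_right fun h => ⟨h.1, fun hfe => by
        have := h.2 e.val.1 (hfe ▸ Sym2.mem_mk_left _ _)
        simp [normInf] at this⟩
    rw [hR' e he hω, ENNReal.ofReal_le_natCast, div_le_iff₀ (by positivity)]
    linarith
  · obtain ⟨Γ, hΓ, hfar, W, ho, hc⟩ := exists_separated_detours R g.edges hdet g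
      fun _ h => .inl h
    have hRr : ∀ e ∈ Γ, (ReffENN d Cstar n e ω).toReal = R s(e.val.1, e.val.2) := fun e he => by
      rw [hR' e (hΓ e he).1 (hΓ e he).2, ENNReal.toReal_natCast]
    refine ⟨Γ, hΓ, fun e he e' he' hee => ?_, ?_⟩
    · rw [hRr e he, hRr e' he']
      exact_mod_cast hfar e he e' he' hee
    have hT : passageTime d n ω a b = walkCost n ω g := by
      refine IsLeast.csInf_eq ⟨⟨g.support, isPath_support g hg, head?_support g,
        getLast?_support g, pathCost_support g⟩, ?_⟩
      rintro _ ⟨l, hl, hx, hy, rfl⟩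
      obtain ⟨w, -, rfl⟩ := hl.exists_walk hx hy
      rw [pathCost_support]
      exact hgeo w
    have hD := chemDist_le_length W.bypass W.bypass_isPath
      fun z hz => ho z (W.edges_bypass_subset_edges hz)
    obtain ⟨w, hw, hwl⟩ := exists_walk_of_chemDist_ne_top
      (ne_top_of_le_ne_top (ENat.natCast_ne_top _) hD)
    have hDr : DstarR d n ω = w.length := by
      change ((chemDist d ω a b).toNat : ℝ) = _
      rw [← hwl, ENat.toNat_natCast]
    have hle : w.length ≤ W.edges.toFinset.card := by
      rw [← hwl] at hD
      have h₁ : w.length ≤ W.bypass.length := by exact_mod_cast hD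
      rw [← W.bypass.length_edges,
        ← List.toFinset_card_of_nodup W.bypass_isPath.isTrail.edges_nodup] at h₁
      refine h₁.trans (Finset.card_le_card fun z hz => ?_)
      rw [List.mem_toFinset] at hz ⊢
      exact W.edges_bypass_subset_edges hz
    have hle' : (w.length : ℝ) ≤ W.edges.toFinset.card := by exact_mod_cast hle
    have hge := hgeo w
    rw [walkCost_eq_length w hw] at hge
    have hopen := card_open_le_walkCost (n := n) (ω := ω) g hg
    rw [hT, hDr, abs_of_nonneg (by linarith), Finset.mul_sum, Finset.sum_congr rfl fun e he => by
      rw [hRr e he]]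
    linarith

end Perco
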